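/- arXiv:1704.07149 — 5 statements merged into one kernel-verified Lean document; each statement's English description precedes it below -/
import Mathlib

section
/- Invertibility of (□R) in TEFL: if the tree sequent Γ ⇒^T Δ, α:@_n□φ is provable in TEFL, then for any natural number i fresh in T, the tree sequent Γ ⇒^{T∪{α·_n i}} Δ, α·_n i:@_nφ is provable in TEFL. -/
set_option autoImplicit false

/-- Formulas of Epistemic Logic of Friendship:
    nominals, propositional variables, ⊥, →, @ₙ, F, □. -/
inductive Form : Type
  | nom : ℕ → Form
  | pv  : ℕ → Form
  | bot : Form
  | imp : Form → Form → Form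
  | atf : ℕ → Form → Form
  | fr  : Form → Form
  | box : Form → Form
  deriving DecidableEq

def Form.neg (φ : Form) : Form := Form.imp φ Form.bot
def Form.top : Form := Form.neg Form.bot
def Form.and (φ ψ : Form) : Form := Form.neg (Form.imp φ (Form.neg ψ))
def Form.or (φ ψ : Form) : Form := Form.imp (Form.neg φ) ψ
def Form.iff (φ ψ : Form) : Form := Form.and (Form.imp φ ψ) (Form.imp ψ φ)
/-- ⟨F⟩φ := ¬F¬φ -/
def Form.diaF (φ : Form) : Form := Form.neg (Form.fr (Form.neg φ))

/-- `Form.sub m k φ` is φ[m/k] : substitute nominal k by nominal m. -/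
def Form.sub (m k : ℕ) : Form → Form
  | .nom n => if n = k then .nom m else .nom n
  | .pv p => .pv p
  | .bot => .bot
  | .imp φ ψ => .imp (Form.sub m k φ) (Form.sub m k ψ)
  | .atf n φ => .atf (if n = k then m else n) (Form.sub m k φ)
  | .fr φ => .fr (Form.sub m k φ)
  | .box φ => .box (Form.sub m k φ)

/-- nominals occurring in a formula -/
def Form.noms : Form → Finset ℕ
  | .nom n => {n}
  | .pv _ => ∅
  | .bot => ∅
  | .imp φ ψ => Form.noms φ ∪ Form.noms ψ
  | .atf n φ => insert n (Form.noms φ)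
  | .fr φ => Form.noms φ
  | .box φ => Form.noms φ

/-- Labels: natural numbers are labels, and `child α n i` is the label α·ₙi,
    an n-child of α. -/
inductive Label : Type
  | root : ℕ → Label
  | child : Label → ℕ → ℕ → Label
  deriving DecidableEq

/-- nominals occurring in a label -/
def Label.noms : Label → Finset ℕ
  | .root _ => ∅
  | .child α n _ => insert n (Label.noms α)

/-- natural numbers occurring in a label -/
def Label.nats : Label → Finset ℕ
  | .root j => {j}
  | .child α _ i => insert i (Label.nats α)

/-- apply a nominal renaming to (the edge nominals of) a label -/
def Label.subst (σn : ℕ → ℕ) : Label → Label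
  | .root j => .root j
  | .child α n i => .child (Label.subst σn α) (σn n) i

/-- A labelled formula (α, φ) stands for α:φ, where φ is intended @-prefixed. -/
abbrev LForm : Type := Label × Form

/-- A finite tree of labels: a unique natural-number root, closed under parents. -/
def IsTree (T : Finset Label) : Prop :=
  (∃! j : ℕ, Label.root j ∈ T) ∧ ∀ α n i, Label.child α n i ∈ T → α ∈ T

/-- A (possibly infinite) tree of labels. -/
def SetIsTree (T : Set Label) : Prop :=
  (∃! j : ℕ, Label.root j ∈ T) ∧ ∀ α n i, Label.child α n i ∈ T → α ∈ T

/-- A frame: states, agents, accessibility Rₐ and friendship ≍_w. -/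
structure Frame (W A : Type) : Type where
  wne : Nonempty W
  ane : Nonempty A
  R : A → W → W → Prop
  friend : W → A → A → Prop

/-- A model: a frame with a valuation; nominals denote unique agents via `Vn`
    (this builds in V(n) = W × {n̲}). -/
structure Model (W A : Type) extends Frame W A where
  Vp : ℕ → W → A → Prop
  Vn : ℕ → A

section Semantics
variable {W A : Type}

/-- Two-dimensional satisfaction M,(w,a) ⊨ φ. -/
def Sat (M : Model W A) : W → A → Form → Prop
  | _, a, .nom n => M.Vn n = a
  | w, a, .pv p => M.Vp p w a
  | _, _, .bot => False
  | w, a, .imp φ ψ => Sat M w a φ → Sat M w a ψ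
  | w, _, .atf n φ => Sat M w (M.Vn n) φ
  | w, a, .fr φ => ∀ b, M.friend w a b → Sat M w b φ
  | w, a, .box φ => ∀ v, M.R a w v → Sat M v a φ

/-- f is a T-assignment: it respects the n-child edges of T. -/
def IsAssign (M : Model W A) (T : Finset Label) (f : Label → W) : Prop :=
  ∀ α n i, Label.child α n i ∈ T → M.R (M.Vn n) (f α) (f (Label.child α n i))

/-- Truth of a labelled formula α:@ₙφ at (M,f); for @-prefixed formulas
    the agent coordinate is irrelevant. -/
def LSat (M : Model W A) (f : Label → W) (l : LForm) : Prop :=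
  ∀ a : A, Sat M (f l.1) a l.2

/-- Truth of a tree sequent Γ ⇒ᵀ Δ at (M,f). -/
def SeqTrue (M : Model W A) (f : Label → W) (Γ Δ : Finset LForm) : Prop :=
  (∀ l ∈ Γ, LSat M f l) → ∃ l ∈ Δ, LSat M f l

end Semantics

/-- Nominal m is fresh in the sequent Γ ⇒ᵀ Δ. -/
def FreshNom (m : ℕ) (T : Finset Label) (Γ Δ : Finset LForm) : Prop :=
  (∀ β ∈ T, m ∉ Label.noms β) ∧
    (∀ l ∈ Γ, m ∉ Label.noms l.1 ∧ m ∉ Form.noms l.2) ∧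
    (∀ l ∈ Δ, m ∉ Label.noms l.1 ∧ m ∉ Form.noms l.2)

/-- Natural number i is fresh in the sequent Γ ⇒ᵀ Δ. -/
def FreshNat (i : ℕ) (T : Finset Label) (Γ Δ : Finset LForm) : Prop :=
  (∀ β ∈ T, i ∉ Label.nats β) ∧
    (∀ l ∈ Γ, i ∉ Label.nats l.1) ∧ (∀ l ∈ Δ, i ∉ Label.nats l.1)

/-- Tree-sequent derivations of height ≤ h.  `Deriv true` is TEFL (with Cut),
    `Deriv false` is TEFL⁻ (without Cut). -/
inductive Deriv (c : Bool) : Finset Label → Finset LForm → Finset LForm → ℕ → Prop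
  | bot {T : Finset Label} {Γ Δ : Finset LForm} (α : Label) (n : ℕ) :
      Deriv c T (insert (α, Form.atf n Form.bot) Γ) Δ 0
  | id {T : Finset Label} {Γ Δ : Finset LForm} (α : Label) (n : ℕ) (φ : Form) :
      Deriv c T (insert (α, Form.atf n φ) Γ) (insert (α, Form.atf n φ) Δ) 0
  | rep1 {T : Finset Label} {Γ Δ : Finset LForm} {h : ℕ} (α : Label) (n m k : ℕ) (φ : Form) :
      Deriv c T (insert (α, Form.atf n (Form.nom m)) (insert (α, Form.sub n k φ) Γ)) Δ h →
      Deriv c T (insert (α, Form.atf n (Form.nom m)) (insert (α, Form.sub m k φ) Γ)) Δ (h+1)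
  | rep2 {T : Finset Label} {Γ Δ : Finset LForm} {h : ℕ} (α : Label) (n m k : ℕ) (φ : Form) :
      Deriv c T (insert (α, Form.atf n (Form.nom m)) (insert (α, Form.sub m k φ) Γ)) Δ h →
      Deriv c T (insert (α, Form.atf n (Form.nom m)) (insert (α, Form.sub n k φ) Γ)) Δ (h+1)
  | refl {T : Finset Label} {Γ Δ : Finset LForm} {h : ℕ} (α : Label) (n : ℕ) :
      α ∈ T →
      Deriv c T (insert (α, Form.atf n (Form.nom n)) Γ) Δ h →
      Deriv c T Γ Δ (h+1)
  | rigid {T : Finset Label} {Γ Δ : Finset LForm} {h : ℕ} (α β : Label) (n m : ℕ) :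
      β ∈ T →
      Deriv c T (insert (β, Form.atf n (Form.nom m)) Γ) Δ h →
      Deriv c T (insert (α, Form.atf n (Form.nom m)) Γ) Δ (h+1)
  | impR {T : Finset Label} {Γ Δ : Finset LForm} {h : ℕ} (α : Label) (n : ℕ) (φ ψ : Form) :
      Deriv c T (insert (α, Form.atf n φ) Γ) (insert (α, Form.atf n ψ) Δ) h →
      Deriv c T Γ (insert (α, Form.atf n (Form.imp φ ψ)) Δ) (h+1)
  | impL {T : Finset Label} {Γ Δ : Finset LForm} {h₁ h₂ : ℕ} (α : Label) (n : ℕ) (φ ψ : Form) :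
      Deriv c T Γ (insert (α, Form.atf n φ) Δ) h₁ →
      Deriv c T (insert (α, Form.atf n ψ) Γ) Δ h₂ →
      Deriv c T (insert (α, Form.atf n (Form.imp φ ψ)) Γ) Δ (max h₁ h₂ + 1)
  | atR {T : Finset Label} {Γ Δ : Finset LForm} {h : ℕ} (α : Label) (n m : ℕ) (φ : Form) :
      Deriv c T Γ (insert (α, Form.atf m φ) Δ) h →
      Deriv c T Γ (insert (α, Form.atf n (Form.atf m φ)) Δ) (h+1)
  | atL {T : Finset Label} {Γ Δ : Finset LForm} {h : ℕ} (α : Label) (n m : ℕ) (φ : Form) :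
      Deriv c T (insert (α, Form.atf m φ) Γ) Δ h →
      Deriv c T (insert (α, Form.atf n (Form.atf m φ)) Γ) Δ (h+1)
  | frR {T : Finset Label} {Γ Δ : Finset LForm} {h : ℕ} (α : Label) (n m : ℕ) (φ : Form) :
      FreshNom m T Γ (insert (α, Form.atf n (Form.fr φ)) Δ) →
      Deriv c T (insert (α, Form.atf n (Form.diaF (Form.nom m))) Γ)
        (insert (α, Form.atf m φ) Δ) h →
      Deriv c T Γ (insert (α, Form.atf n (Form.fr φ)) Δ) (h+1)
  | frL {T : Finset Label} {Γ Δ : Finset LForm} {h₁ h₂ : ℕ} (α : Label) (n m : ℕ) (φ : Form) :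
      Deriv c T Γ (insert (α, Form.atf n (Form.diaF (Form.nom m))) Δ) h₁ →
      Deriv c T (insert (α, Form.atf m φ) Γ) Δ h₂ →
      Deriv c T (insert (α, Form.atf n (Form.fr φ)) Γ) Δ (max h₁ h₂ + 1)
  | boxR {T : Finset Label} {Γ Δ : Finset LForm} {h : ℕ} (α : Label) (n i : ℕ) (φ : Form) :
      FreshNat i T Γ (insert (α, Form.atf n (Form.box φ)) Δ) →
      Deriv c (insert (Label.child α n i) T) Γ
        (insert (Label.child α n i, Form.atf n φ) Δ) h →
      Deriv c T Γ (insert (α, Form.atf n (Form.box φ)) Δ) (h+1)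
  | boxL {T : Finset Label} {Γ Δ : Finset LForm} {h : ℕ} (α : Label) (n i : ℕ) (φ : Form) :
      Label.child α n i ∈ T →
      Deriv c T (insert (Label.child α n i, Form.atf n φ) Γ) Δ h →
      Deriv c T (insert (α, Form.atf n (Form.box φ)) Γ) Δ (h+1)
  | wlab {T : Finset Label} {Γ Δ : Finset LForm} {h : ℕ} (α : Label) :
      IsTree (insert α T) →
      Deriv c T Γ Δ h →
      Deriv c (insert α T) Γ Δ (h+1)
  | cut {T : Finset Label} {Γ Δ P S : Finset LForm} {h₁ h₂ : ℕ} (α : Label) (n : ℕ) (φ : Form) :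
      c = true → α ∈ T →
      Deriv c T Γ (insert (α, Form.atf n φ) Δ) h₁ →
      Deriv c T (insert (α, Form.atf n φ) P) S h₂ →
      Deriv c T (Γ ∪ P) (Δ ∪ S) (max h₁ h₂ + 1)

/-- Provability of a finite tree sequent (`true` = TEFL, `false` = TEFL⁻). -/
def Provable (c : Bool) (T : Finset Label) (Γ Δ : Finset LForm) : Prop :=
  ∃ h : ℕ, Deriv c T Γ Δ h

/-- Provability of a possibly infinite tree sequent in TEFL⁻ :
    some finite subsequent over a finite subtree is provable. -/
def InfProvable (T : Set Label) (Γ Δ : Set LForm) : Prop :=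
  ∃ (T' : Finset Label) (Γ' Δ' : Finset LForm),
    ↑T' ⊆ T ∧ IsTree T' ∧ ↑Γ' ⊆ Γ ∧ ↑Δ' ⊆ Δ ∧ Provable false T' Γ' Δ'

/-- Saturation conditions for a possibly infinite tree sequent. -/
structure Saturated (T : Set Label) (Γ Δ : Set LForm) : Prop where
  rep1 : ∀ (α : Label) (n m k : ℕ) (φ : Form),
    (α, Form.atf n (Form.nom m)) ∈ Γ → (α, Form.sub n k φ) ∈ Γ → (α, Form.sub m k φ) ∈ Γ
  rep2 : ∀ (α : Label) (n m k : ℕ) (φ : Form),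
    (α, Form.atf m (Form.nom n)) ∈ Γ → (α, Form.sub n k φ) ∈ Γ → (α, Form.sub m k φ) ∈ Γ
  refl : ∀ α ∈ T, ∀ n : ℕ, (α, Form.atf n (Form.nom n)) ∈ Γ
  rigid : ∀ (α β : Label) (n m : ℕ), β ∈ T →
    (α, Form.atf n (Form.nom m)) ∈ Γ → (β, Form.atf n (Form.nom m)) ∈ Γ
  impR : ∀ (α : Label) (n : ℕ) (φ ψ : Form), (α, Form.atf n (Form.imp φ ψ)) ∈ Δ →
    (α, Form.atf n φ) ∈ Γ ∧ (α, Form.atf n ψ) ∈ Δ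
  impL : ∀ (α : Label) (n : ℕ) (φ ψ : Form), (α, Form.atf n (Form.imp φ ψ)) ∈ Γ →
    (α, Form.atf n φ) ∈ Δ ∨ (α, Form.atf n ψ) ∈ Γ
  atR : ∀ (α : Label) (n m : ℕ) (φ : Form), (α, Form.atf n (Form.atf m φ)) ∈ Δ →
    (α, Form.atf m φ) ∈ Δ
  atL : ∀ (α : Label) (n m : ℕ) (φ : Form), (α, Form.atf n (Form.atf m φ)) ∈ Γ →
    (α, Form.atf m φ) ∈ Γ
  frR : ∀ (α : Label) (n : ℕ) (φ : Form), (α, Form.atf n (Form.fr φ)) ∈ Δ →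
    ∃ m : ℕ, (α, Form.atf n (Form.diaF (Form.nom m))) ∈ Γ ∧ (α, Form.atf m φ) ∈ Δ
  frL : ∀ (α : Label) (n : ℕ) (φ : Form), (α, Form.atf n (Form.fr φ)) ∈ Γ →
    ∀ m : ℕ, (α, Form.atf n (Form.diaF (Form.nom m))) ∈ Δ ∨ (α, Form.atf m φ) ∈ Γ
  boxR : ∀ (α : Label) (n : ℕ) (φ : Form), (α, Form.atf n (Form.box φ)) ∈ Δ →
    ∃ i : ℕ, Label.child α n i ∈ T ∧ (Label.child α n i, Form.atf n φ) ∈ Δ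
  boxL : ∀ (α : Label) (n : ℕ) (φ : Form), (α, Form.atf n (Form.box φ)) ∈ Γ →
    ∀ i : ℕ, Label.child α n i ∈ T → (Label.child α n i, Form.atf n φ) ∈ Γ

/-- n ~ m iff α:@ₙm ∈ Γ for some α ∈ T. -/
def nrel (T : Set Label) (Γ : Set LForm) (n m : ℕ) : Prop :=
  ∃ α ∈ T, (α, Form.atf n (Form.nom m)) ∈ Γ

/-- Propositional tautology (instance): true under every boolean valuation
    respecting ⊥ and →. -/
def IsTaut (φ : Form) : Prop :=
  ∀ v : Form → Bool, v Form.bot = false →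
    (∀ ψ χ : Form, v (Form.imp ψ χ) = (!(v ψ) || v χ)) → v φ = true

/-- Uniform substitution: propositional variables by formulas, nominals by nominals. -/
def ApplySub (σp : ℕ → Form) (σn : ℕ → ℕ) : Form → Form
  | .nom n => .nom (σn n)
  | .pv p => σp p
  | .bot => .bot
  | .imp φ ψ => .imp (ApplySub σp σn φ) (ApplySub σp σn ψ)
  | .atf n φ => .atf (σn n) (ApplySub σp σn φ)
  | .fr φ => .fr (ApplySub σp σn φ)
  | .box φ => .box (ApplySub σp σn φ)

/-- Necessity forms L ::= # | ψ→L | @ₙ□L. -/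
inductive NForm : Type
  | hole : NForm
  | imp : Form → NForm → NForm
  | atBox : ℕ → NForm → NForm

/-- L(χ): replace the unique occurrence of # in L by χ. -/
def NForm.fill : NForm → Form → Form
  | .hole, χ => χ
  | .imp ψ L, χ => Form.imp ψ (NForm.fill L χ)
  | .atBox n L, χ => Form.atf n (Form.box (NForm.fill L χ))

/-- The Hilbert system HEFL, extended by an extra set `ax` of axioms
    (HEFL itself is `Hil ∅`). -/
inductive Hil (ax : Set Form) : Form → Prop
  | extra {φ : Form} : φ ∈ ax → Hil ax φ
  | taut {φ : Form} : IsTaut φ → Hil ax φ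
  | kBox (p q : ℕ) : Hil ax (Form.imp (Form.box (Form.imp (Form.pv p) (Form.pv q)))
      (Form.imp (Form.box (Form.pv p)) (Form.box (Form.pv q))))
  | kF (p q : ℕ) : Hil ax (Form.imp (Form.fr (Form.imp (Form.pv p) (Form.pv q)))
      (Form.imp (Form.fr (Form.pv p)) (Form.fr (Form.pv q))))
  | kAt (n p q : ℕ) : Hil ax (Form.imp (Form.atf n (Form.imp (Form.pv p) (Form.pv q)))
      (Form.imp (Form.atf n (Form.pv p)) (Form.atf n (Form.pv q))))
  | refAx (n : ℕ) : Hil ax (Form.atf n (Form.nom n))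
  | selfdual (n p : ℕ) : Hil ax (Form.iff (Form.neg (Form.atf n (Form.pv p)))
      (Form.atf n (Form.neg (Form.pv p))))
  | elim (n p : ℕ) : Hil ax (Form.imp (Form.atf n (Form.pv p))
      (Form.imp (Form.nom n) (Form.pv p)))
  | agree (n m p : ℕ) : Hil ax (Form.imp (Form.atf n (Form.atf m (Form.pv p)))
      (Form.atf m (Form.pv p)))
  | back (n p : ℕ) : Hil ax (Form.imp (Form.atf n (Form.pv p))
      (Form.fr (Form.atf n (Form.pv p))))
  | dcom (n p : ℕ) : Hil ax (Form.iff (Form.atf n (Form.box (Form.atf n (Form.pv p))))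
      (Form.atf n (Form.box (Form.pv p))))
  | rigidEq (n m : ℕ) : Hil ax (Form.imp (Form.atf n (Form.nom m))
      (Form.box (Form.atf n (Form.nom m))))
  | rigidNeq (n m : ℕ) : Hil ax (Form.imp (Form.neg (Form.atf n (Form.nom m)))
      (Form.box (Form.neg (Form.atf n (Form.nom m)))))
  | mp {φ ψ : Form} : Hil ax (Form.imp φ ψ) → Hil ax φ → Hil ax ψ
  | necBox {φ : Form} : Hil ax φ → Hil ax (Form.box φ)
  | necF {φ : Form} : Hil ax φ → Hil ax (Form.fr φ)
  | necAt {φ : Form} (n : ℕ) : Hil ax φ → Hil ax (Form.atf n φ)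
  | us {φ : Form} (σp : ℕ → Form) (σn : ℕ → ℕ) : Hil ax φ → Hil ax (ApplySub σp σn φ)
  | name {φ : Form} (n : ℕ) : n ∉ Form.noms φ →
      Hil ax (Form.imp (Form.nom n) φ) → Hil ax φ
  | lbg {φ : Form} (L : NForm) (n m : ℕ) :
      m ∉ Form.noms (NForm.fill L (Form.atf n (Form.fr φ))) →
      Hil ax (NForm.fill L (Form.imp (Form.atf n (Form.diaF (Form.nom m))) (Form.atf m φ))) →
      Hil ax (NForm.fill L (Form.atf n (Form.fr φ)))

/-- finite conjunction (empty = ⊤) -/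
def conjList : List Form → Form
  | [] => Form.top
  | φ :: l => Form.and φ (conjList l)

/-- finite disjunction (empty = ⊥) -/
def disjList : List Form → Form
  | [] => Form.bot
  | φ :: l => Form.or φ (disjList l)

/-- Formulaic translation, with a fuel parameter bounding the recursion depth. -/
noncomputable def translAux : ℕ → Finset Label → Finset LForm → Finset LForm → Label → Form
  | 0, _, _, _, _ => Form.bot
  | d+1, T, Γ, Δ, α =>
    Form.imp (conjList ((Γ.filter (fun l => l.1 = α)).toList.map Prod.snd))
      (disjList (((Δ.filter (fun l => l.1 = α)).toList.map Prod.snd) ++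
        (T.toList.filterMap (fun β =>
          match β with
          | Label.child γ n i =>
            if γ = α then
              some (Form.atf n (Form.box (translAux d T Γ Δ (Label.child γ n i))))
            else none
          | Label.root _ => none))))

/-- ⟦Γ ⇒ᵀ Δ⟧_α : the formulaic translation of a tree sequent at label α. -/
noncomputable def transl (T : Finset Label) (Γ Δ : Finset LForm) (α : Label) : Form :=
  translAux (T.card + 1) T Γ Δ α

section FrameValidity
variable {W A : Type}

/-- A formula is valid in a frame: true under every valuation at every pair. -/
def FrameValid (F : Frame W A) (φ : Form) : Prop :=
  ∀ (Vp : ℕ → W → A → Prop) (Vn : ℕ → A) (w : W) (a : A),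
    Sat { toFrame := F, Vp := Vp, Vn := Vn } w a φ

end FrameValidity

/-- Formulas of the shape @ₙm or @ₙ⟨F⟩m. -/
def IsRho (φ : Form) : Prop :=
  (∃ n m : ℕ, φ = Form.atf n (Form.nom m)) ∨
    (∃ n m : ℕ, φ = Form.atf n (Form.diaF (Form.nom m)))

/-- Regular implications (ρ₁ ∧ … ∧ ρ_h) → (ρ₁' ∨ … ∨ ρ_l'). -/
def IsRegImp (φ : Form) : Prop :=
  ∃ l₁ l₂ : List Form, (∀ ρ ∈ l₁, IsRho ρ) ∧ (∀ ρ ∈ l₂, IsRho ρ) ∧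
    φ = Form.imp (conjList l₁) (disjList l₂)

/-- S4 := {□p→p, □p→□□p}. -/
def S4Ax : Set Form :=
  {Form.imp (Form.box (Form.pv 0)) (Form.pv 0),
   Form.imp (Form.box (Form.pv 0)) (Form.box (Form.box (Form.pv 0)))}

/-- S5 := S4 ∪ {p→□¬□¬p}. -/
def S5Ax : Set Form :=
  S4Ax ∪ {Form.imp (Form.pv 0)
    (Form.box (Form.neg (Form.box (Form.neg (Form.pv 0)))))}

/-- invertibility of (□R) in TEFL. -/
theorem boxR_invertible (T : Finset Label) (Γ Δ : Finset LForm)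
    (α : Label) (n i : ℕ) (φ : Form)
    (hT : IsTree T) (hα : α ∈ T) (hΓ : ∀ l ∈ Γ, l.1 ∈ T) (hΔ : ∀ l ∈ Δ, l.1 ∈ T)
    (hfresh : ∀ β ∈ T, i ∉ Label.nats β)
    (hprov : Provable true T Γ (insert (α, Form.atf n (Form.box φ)) Δ)) :
    Provable true (insert (Label.child α n i) T) Γ
      (insert (Label.child α n i, Form.atf n φ) Δ) := by
  obtain ⟨h, d⟩ := hprov
  have hT' : IsTree (insert (Label.child α n i) T) := by
    refine ⟨by simpa using hT.1, fun β m j hβ => ?_⟩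
    rcases Finset.mem_insert.1 hβ with heq | hmem
    · cases heq
      exact Finset.mem_insert_of_mem hα
    · exact Finset.mem_insert_of_mem (hT.2 β m j hmem)
  have hbox : Deriv true (insert (Label.child α n i) T)
      (insert (α, Form.atf n (Form.box φ)) ∅) {(Label.child α n i, Form.atf n φ)} (0 + 1) :=
    Deriv.boxL α n i φ (Finset.mem_insert_self _ _) (Deriv.id (Δ := ∅) _ n φ)
  have hcut := Deriv.cut α n (Form.box φ) rfl (Finset.mem_insert_of_mem hα)
    (Deriv.wlab _ hT' d) hbox
  rw [Finset.union_empty, Finset.union_comm, ← Finset.insert_eq] at hcut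
  exact ⟨_, hcut⟩
end

section
/- Invertibility of (@R) and (@L) in TEFL: if the tree sequent Γ ⇒^T Δ, α:@_n@_mφ is provable in TEFL then Γ ⇒^T Δ, α:@_mφ is provable in TEFL; and if α:@_n@_mφ, Γ ⇒^T Δ is provable in TEFL then α:@_mφ, Γ ⇒^T Δ is provable in TEFL. -/
set_option autoImplicit false

/-- invertibility of (@R) and (@L) in TEFL. -/
theorem atR_atL_invertible (T : Finset Label) (Γ Δ : Finset LForm)
    (α : Label) (n m : ℕ) (φ : Form)
    (hT : IsTree T) (hα : α ∈ T) (hΓ : ∀ l ∈ Γ, l.1 ∈ T) (hΔ : ∀ l ∈ Δ, l.1 ∈ T) :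
    (Provable true T Γ (insert (α, Form.atf n (Form.atf m φ)) Δ) →
      Provable true T Γ (insert (α, Form.atf m φ) Δ)) ∧
    (Provable true T (insert (α, Form.atf n (Form.atf m φ)) Γ) Δ →
      Provable true T (insert (α, Form.atf m φ) Γ) Δ) := by
  constructor
  · rintro ⟨h, d⟩
    have collapse : Deriv true T (insert (α, Form.atf n (Form.atf m φ)) ∅)
        (insert (α, Form.atf m φ) ∅) 1 := .atL α n m φ (.id α m φ)
    have e := Deriv.cut α n (Form.atf m φ) rfl hα d collapse
    rw [Finset.union_empty, Finset.union_insert, Finset.union_empty] at e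
    exact ⟨_, e⟩
  · rintro ⟨h, d⟩
    have expand : Deriv true T (insert (α, Form.atf m φ) ∅)
        (insert (α, Form.atf n (Form.atf m φ)) ∅) 1 := .atR α n m φ (.id α m φ)
    have e := Deriv.cut α n (Form.atf m φ) rfl hα expand d
    rw [Finset.insert_union, Finset.empty_union, Finset.empty_union] at e
    exact ⟨_, e⟩
end

section
/- If a formula φ is provable in the Hilbert system HEFL, then for every finite tree T, every label α ∈ T, and every nominal n not occurring in φ, the tree sequent ⇒^T α:@_nφ (with empty antecedent) is provable in TEFL. -/
set_option autoImplicit false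

/-! ### Substitution -/

theorem ApplySub_comp (σp τp : ℕ → Form) (σn τn : ℕ → ℕ) (φ : Form) :
    ApplySub σp σn (ApplySub τp τn φ) =
      ApplySub (fun p => ApplySub σp σn (τp p)) (fun n => σn (τn n)) φ := by
  induction φ <;> simp_all [ApplySub]

theorem ApplySub_id (φ : Form) : ApplySub Form.pv (fun n => n) φ = φ := by
  induction φ <;> simp_all [ApplySub]

theorem ApplySub_update (σp : ℕ → Form) (σn : ℕ → ℕ) (n m : ℕ) (φ : Form)
    (hn : n ∉ φ.noms) :
    ApplySub σp (Function.update σn n m) φ = ApplySub σp σn φ := by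
  induction φ <;> simp_all [ApplySub, Form.noms, Function.update_apply] <;> grind

theorem Form.sub_of_notMem (m k : ℕ) (φ : Form) (hk : k ∉ φ.noms) : Form.sub m k φ = φ := by
  induction φ <;> simp_all [Form.sub, Form.noms] <;> grind

theorem IsTaut.applySub {φ : Form} (h : IsTaut φ) (σp : ℕ → Form) (σn : ℕ → ℕ) :
    IsTaut (ApplySub σp σn φ) := fun v hbot himp =>
  h (fun ψ => v (ApplySub σp σn ψ)) (by simpa [ApplySub] using hbot)
    (fun ψ χ => by simpa [ApplySub] using himp _ _)

/-- Substitution in a necessity form. -/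
def NForm.applySub (σp : ℕ → Form) (σn : ℕ → ℕ) : NForm → NForm
  | .hole => .hole
  | .imp ψ L => .imp (ApplySub σp σn ψ) (NForm.applySub σp σn L)
  | .atBox n L => .atBox (σn n) (NForm.applySub σp σn L)

theorem NForm.applySub_fill (σp : ℕ → Form) (σn : ℕ → ℕ) (L : NForm) (χ : Form) :
    ApplySub σp σn (L.fill χ) = (L.applySub σp σn).fill (ApplySub σp σn χ) := by
  induction L <;> simp_all [ApplySub, NForm.fill, NForm.applySub]

theorem NForm.applySub_update (σp : ℕ → Form) (σn : ℕ → ℕ) (n m : ℕ) (L : NForm) (χ : Form)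
    (hn : n ∉ (L.fill χ).noms) :
    L.applySub σp (Function.update σn n m) = L.applySub σp σn := by
  induction L with
  | hole => rfl
  | imp ψ L ih =>
    simp_all [NForm.fill, NForm.applySub, Form.noms, ApplySub_update]
  | atBox k L ih =>
    simp_all [NForm.fill, NForm.applySub, Form.noms, Function.update_apply]
    grind

theorem NForm.notMem_noms_of_fill (n : ℕ) (L : NForm) (χ : Form)
    (hn : n ∉ (L.fill χ).noms) : n ∉ χ.noms := by
  induction L <;> simp_all [NForm.fill, Form.noms]

/-! ### Trees and freshness -/

theorem IsTree.insert_child {T : Finset Label} (hT : IsTree T) {α : Label} (hα : α ∈ T)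
    (n i : ℕ) : IsTree (insert (Label.child α n i) T) := by
  obtain ⟨⟨j, hj, hu⟩, hp⟩ := hT
  refine ⟨⟨j, by simp [hj], fun k hk => hu k (by simpa using hk)⟩, fun β m k h => ?_⟩
  rcases Finset.mem_insert.1 h with h | h
  · cases h
    exact Finset.mem_insert_of_mem hα
  · exact Finset.mem_insert_of_mem (hp _ _ _ h)

theorem exists_freshNat (T : Finset Label) (Γ Δ : Finset LForm) :
    ∃ i, FreshNat i T Γ Δ := by
  obtain ⟨i, hi⟩ := Infinite.exists_notMem_finset
    (T.biUnion Label.nats ∪ (Γ ∪ Δ).biUnion fun l => l.1.nats)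
  simp only [Finset.mem_union, Finset.mem_biUnion, not_or, not_exists, not_and] at hi
  exact ⟨i, hi.1, fun l hl => hi.2 l (.inl hl), fun l hl => hi.2 l (.inr hl)⟩

theorem exists_freshNom (T : Finset Label) (Γ Δ : Finset LForm) :
    ∃ m, FreshNom m T Γ Δ := by
  obtain ⟨m, hm⟩ := Infinite.exists_notMem_finset
    (T.biUnion Label.noms ∪ (Γ ∪ Δ).biUnion fun l => l.1.noms ∪ l.2.noms)
  simp only [Finset.mem_union, Finset.mem_biUnion, not_or, not_exists, not_and] at hm
  exact ⟨m, hm.1, fun l hl => hm.2 l (.inl hl), fun l hl => hm.2 l (.inr hl)⟩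

/-! ### Rules of TEFL for provability, with cumulative left rules -/

namespace Provable

variable {T : Finset Label} {Γ Δ : Finset LForm} {α : Label} {n m : ℕ} {φ ψ : Form}

theorem ax (α : Label) (n : ℕ) (φ : Form) (hΓ : (α, Form.atf n φ) ∈ Γ)
    (hΔ : (α, Form.atf n φ) ∈ Δ) : Provable true T Γ Δ := by
  rw [← Finset.insert_eq_of_mem hΓ, ← Finset.insert_eq_of_mem hΔ]
  exact ⟨0, .id α n φ⟩

theorem botL (α : Label) (n : ℕ) (hΓ : (α, Form.atf n Form.bot) ∈ Γ) :
    Provable true T Γ Δ := by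
  rw [← Finset.insert_eq_of_mem hΓ]
  exact ⟨0, .bot α n⟩

theorem refl (α : Label) (n : ℕ) (hα : α ∈ T)
    (h : Provable true T (insert (α, Form.atf n (Form.nom n)) Γ) Δ) : Provable true T Γ Δ :=
  let ⟨_, d⟩ := h
  ⟨_, .refl α n hα d⟩

theorem rigid (α β : Label) (n m : ℕ) (hβ : β ∈ T) (hΓ : (α, Form.atf n (Form.nom m)) ∈ Γ)
    (h : Provable true T (insert (β, Form.atf n (Form.nom m)) Γ) Δ) : Provable true T Γ Δ := by
  obtain ⟨_, d⟩ := h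
  have := Deriv.rigid α β n m hβ d
  rw [Finset.insert_eq_of_mem hΓ] at this
  exact ⟨_, this⟩

theorem impR (h : Provable true T (insert (α, Form.atf n φ) Γ) (insert (α, Form.atf n ψ) Δ)) :
    Provable true T Γ (insert (α, Form.atf n (Form.imp φ ψ)) Δ) :=
  let ⟨_, d⟩ := h
  ⟨_, .impR α n φ ψ d⟩

theorem impL (α : Label) (n : ℕ) (φ ψ : Form) (hΓ : (α, Form.atf n (Form.imp φ ψ)) ∈ Γ)
    (h₁ : Provable true T Γ (insert (α, Form.atf n φ) Δ))
    (h₂ : Provable true T (insert (α, Form.atf n ψ) Γ) Δ) : Provable true T Γ Δ := by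
  obtain ⟨_, d₁⟩ := h₁
  obtain ⟨_, d₂⟩ := h₂
  have := Deriv.impL α n φ ψ d₁ d₂
  rw [Finset.insert_eq_of_mem hΓ] at this
  exact ⟨_, this⟩

theorem atR (h : Provable true T Γ (insert (α, Form.atf m φ) Δ)) :
    Provable true T Γ (insert (α, Form.atf n (Form.atf m φ)) Δ) :=
  let ⟨_, d⟩ := h
  ⟨_, .atR α n m φ d⟩

theorem atL (α : Label) (n m : ℕ) (φ : Form) (hΓ : (α, Form.atf n (Form.atf m φ)) ∈ Γ)
    (h : Provable true T (insert (α, Form.atf m φ) Γ) Δ) : Provable true T Γ Δ := by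
  obtain ⟨_, d⟩ := h
  have := Deriv.atL α n m φ d
  rw [Finset.insert_eq_of_mem hΓ] at this
  exact ⟨_, this⟩

theorem frR (h : ∀ m, FreshNom m T Γ (insert (α, Form.atf n (Form.fr φ)) Δ) →
      Provable true T (insert (α, Form.atf n (Form.diaF (Form.nom m))) Γ)
        (insert (α, Form.atf m φ) Δ)) :
    Provable true T Γ (insert (α, Form.atf n (Form.fr φ)) Δ) :=
  let ⟨m, hm⟩ := exists_freshNom T Γ (insert (α, Form.atf n (Form.fr φ)) Δ)
  let ⟨_, d⟩ := h m hm
  ⟨_, .frR α n m φ hm d⟩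

theorem frL (α : Label) (n m : ℕ) (φ : Form) (hΓ : (α, Form.atf n (Form.fr φ)) ∈ Γ)
    (h₁ : Provable true T Γ (insert (α, Form.atf n (Form.diaF (Form.nom m))) Δ))
    (h₂ : Provable true T (insert (α, Form.atf m φ) Γ) Δ) : Provable true T Γ Δ := by
  obtain ⟨_, d₁⟩ := h₁
  obtain ⟨_, d₂⟩ := h₂
  have := Deriv.frL α n m φ d₁ d₂
  rw [Finset.insert_eq_of_mem hΓ] at this
  exact ⟨_, this⟩

theorem boxR (h : ∀ i, Provable true (insert (Label.child α n i) T) Γ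
      (insert (Label.child α n i, Form.atf n φ) Δ)) :
    Provable true T Γ (insert (α, Form.atf n (Form.box φ)) Δ) :=
  let ⟨i, hi⟩ := exists_freshNat T Γ (insert (α, Form.atf n (Form.box φ)) Δ)
  let ⟨_, d⟩ := h i
  ⟨_, .boxR α n i φ hi d⟩

theorem boxL (α : Label) (n i : ℕ) (φ : Form) (hi : Label.child α n i ∈ T)
    (hΓ : (α, Form.atf n (Form.box φ)) ∈ Γ)
    (h : Provable true T (insert (Label.child α n i, Form.atf n φ) Γ) Δ) :
    Provable true T Γ Δ := by
  obtain ⟨_, d⟩ := h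
  have := Deriv.boxL α n i φ hi d
  rw [Finset.insert_eq_of_mem hΓ] at this
  exact ⟨_, this⟩

theorem wlab (hT : IsTree (insert α T)) (h : Provable true T Γ Δ) :
    Provable true (insert α T) Γ Δ :=
  let ⟨_, d⟩ := h
  ⟨_, .wlab α hT d⟩

theorem cut {Γ' Δ' : Finset LForm} (hα : α ∈ T)
    (h₁ : Provable true T Γ (insert (α, Form.atf n φ) Δ))
    (h₂ : Provable true T (insert (α, Form.atf n φ) Γ') Δ') (hΓ : Γ ⊆ Γ') (hΔ : Δ ⊆ Δ') :
    Provable true T Γ' Δ' := by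
  obtain ⟨_, d₁⟩ := h₁
  obtain ⟨_, d₂⟩ := h₂
  have := Deriv.cut α n φ rfl hα d₁ d₂
  rw [Finset.union_eq_right.2 hΓ, Finset.union_eq_right.2 hΔ] at this
  exact ⟨_, this⟩

/-- Replacing equal agents in the prefix of an antecedent formula. -/
theorem repPrefix (α : Label) (n m : ℕ) (φ : Form)
    (heq : (α, Form.atf n (Form.nom m)) ∈ Γ) (hΓ : (α, Form.atf m φ) ∈ Γ)
    (h : Provable true T (insert (α, Form.atf n φ) Γ) Δ) : Provable true T Γ Δ := by
  obtain ⟨_, d⟩ := h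
  obtain ⟨k, hk⟩ := Infinite.exists_notMem_finset φ.noms
  have hsub : ∀ j, Form.sub j k (Form.atf k φ) = Form.atf j φ := fun j => by
    simp [Form.sub, Form.sub_of_notMem _ _ _ hk]
  rw [← Finset.insert_eq_of_mem (Finset.mem_insert_of_mem heq), ← hsub n] at d
  have := Deriv.rep1 α n m k (Form.atf k φ) d
  rw [hsub, Finset.insert_eq_of_mem hΓ, Finset.insert_eq_of_mem heq] at this
  exact ⟨_, this⟩

theorem andR (h₁ : Provable true T Γ (insert (α, Form.atf n φ) Δ))
    (h₂ : Provable true T Γ (insert (α, Form.atf n ψ) Δ)) (hα : α ∈ T) :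
    Provable true T Γ (insert (α, Form.atf n (Form.and φ ψ)) Δ) := by
  refine impR (cut hα h₁ (cut hα h₂ ?_ ?_ ?_) ?_ ?_)
  · refine impL α n φ (Form.neg ψ) (by simp) (ax α n φ (by simp) (by simp)) ?_
    exact impL α n ψ Form.bot (by simp [Form.neg]) (ax α n ψ (by simp) (by simp))
      (botL α n (by simp))
  all_goals grind

theorem iffR (h₁ : Provable true T (insert (α, Form.atf n φ) Γ) (insert (α, Form.atf n ψ) Δ))
    (h₂ : Provable true T (insert (α, Form.atf n ψ) Γ) (insert (α, Form.atf n φ) Δ))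
    (hα : α ∈ T) : Provable true T Γ (insert (α, Form.atf n (Form.iff φ ψ)) Δ) :=
  andR (impR h₁) (impR h₂) hα

theorem impR_inv (hα : α ∈ T)
    (h : Provable true T Γ (insert (α, Form.atf n (Form.imp φ ψ)) Δ)) :
    Provable true T (insert (α, Form.atf n φ) Γ) (insert (α, Form.atf n ψ) Δ) :=
  cut hα h (impL α n φ ψ (by simp) (ax α n φ (by simp) (by simp))
    (ax α n ψ (by simp) (by simp))) (Finset.subset_insert _ _) (Finset.subset_insert _ _)

theorem atR_inv (hα : α ∈ T)
    (h : Provable true T Γ (insert (α, Form.atf n (Form.atf m φ)) Δ)) :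
    Provable true T Γ (insert (α, Form.atf m φ) Δ) :=
  cut hα h (atL α n m φ (by simp) (ax α m φ (by simp) (by simp)))
    subset_rfl (Finset.subset_insert _ _)

theorem boxR_inv (hT : IsTree T) (hα : α ∈ T)
    (h : Provable true T Γ (insert (α, Form.atf n (Form.box φ)) Δ)) (i : ℕ) :
    Provable true (insert (Label.child α n i) T) Γ
      (insert (Label.child α n i, Form.atf n φ) Δ) :=
  cut (Finset.mem_insert_of_mem hα) (wlab (hT.insert_child hα n i) h)
    (boxL α n i φ (by simp) (by simp) (ax (Label.child α n i) n φ (by simp) (by simp)))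
    subset_rfl (Finset.subset_insert _ _)

end Provable

/-! ### Tautologies -/

/-- Boolean evaluation of a formula whose prime subformulas are evaluated by `f`. -/
def Form.eval (f : Form → Bool) : Form → Bool
  | .bot => false
  | .imp φ ψ => !(φ.eval f) || ψ.eval f
  | φ => f φ

/-- The prime (neither `⊥` nor implication) constituents of a formula. -/
def Form.primes : Form → Finset Form
  | .bot => ∅
  | .imp φ ψ => φ.primes ∪ ψ.primes
  | φ => {φ}

theorem IsTaut.eval {φ : Form} (h : IsTaut φ) (f : Form → Bool) : φ.eval f = true :=
  h (Form.eval f) rfl fun _ _ => rfl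

namespace Provable

variable {T : Finset Label} {Γ Δ : Finset LForm} {α : Label} {n : ℕ} {φ : Form}

theorem of_eval (f : Form → Bool)
    (hΓ : ∀ ψ ∈ φ.primes, f ψ = true → (α, Form.atf n ψ) ∈ Γ)
    (hΔ : ∀ ψ ∈ φ.primes, f ψ = false → (α, Form.atf n ψ) ∈ Δ) :
    (φ.eval f = true → Provable true T Γ (insert (α, Form.atf n φ) Δ)) ∧
    (φ.eval f = false → Provable true T (insert (α, Form.atf n φ) Γ) Δ) := by
  induction φ generalizing Γ Δ with
  | bot => exact ⟨by simp [Form.eval], fun _ => .botL α n (by simp)⟩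
  | imp φ ψ ihφ ihψ =>
    simp only [Form.primes, Finset.mem_union] at hΓ hΔ
    have ihφ' := @ihφ (insert (α, Form.atf n (Form.imp φ ψ)) Γ) Δ
      (by grind) (by grind)
    have ihψ' := @ihψ (insert (α, Form.atf n φ) Γ) Δ (by grind) (by grind)
    have ihψ'' := @ihψ (insert (α, Form.atf n (Form.imp φ ψ)) Γ) Δ
      (by grind) (by grind)
    have ihφ'' := @ihφ Γ (insert (α, Form.atf n ψ) Δ) (by grind) (by grind)
    refine ⟨fun h => impR ?_, fun h => ?_⟩
    · rcases Bool.or_eq_true_iff.1 h with h | h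
      · exact ihφ''.2 (by simpa using h)
      · exact ihψ'.1 h
    · have h' : φ.eval f = true ∧ ψ.eval f = false := by simpa [Form.eval] using h
      exact impL α n φ ψ (by simp) (ihφ'.1 h'.1) (ihψ''.2 h'.2)
  | _ =>
    exact ⟨fun h => ax α n _ (hΓ _ (by simp [Form.primes]) h) (by simp),
      fun h => ax α n _ (by simp) (hΔ _ (by simp [Form.primes]) h)⟩

theorem of_isTaut (hα : α ∈ T) (hφ : IsTaut φ) (S : Finset Form)
    (hS : ∀ ψ ∈ φ.primes, ψ ∈ S ∨ (α, Form.atf n ψ) ∈ Γ ∨ (α, Form.atf n ψ) ∈ Δ) :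
    Provable true T Γ (insert (α, Form.atf n φ) Δ) := by
  induction S using Finset.induction_on generalizing Γ Δ with
  | empty =>
    exact (of_eval (fun ψ => decide ((α, Form.atf n ψ) ∈ Γ)) (by simp)
      (by simpa [or_iff_not_imp_left] using hS)).1 (hφ.eval _)
  | insert χ S _ ih =>
    refine cut (φ := χ) (n := n) hα ?_ (ih (Γ := insert (α, Form.atf n χ) Γ) (Δ := Δ) (by grind))
      subset_rfl subset_rfl
    rw [Finset.insert_comm]
    exact ih (by grind)

/-! ### The rule `L(BG)` -/

theorem fill_fr {k : ℕ} (L : NForm) (m : ℕ) (hT : IsTree T) (hα : α ∈ T)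
    (h : Provable true T Γ (insert (α, Form.atf k (L.fill (Form.imp
      (Form.atf n (Form.diaF (Form.nom m))) (Form.atf m φ)))) Δ))
    (hm : FreshNom m T Γ (insert (α, Form.atf k (L.fill (Form.atf n (Form.fr φ)))) Δ)) :
    Provable true T Γ (insert (α, Form.atf k (L.fill (Form.atf n (Form.fr φ)))) Δ) := by
  induction L generalizing T Γ Δ α k with
  | hole =>
    have h₁ := atR_inv hα (impR_inv hα h)
    have h₂ : Provable true T (insert (α, Form.atf n (Form.diaF (Form.nom m))) Γ)
        (insert (α, Form.atf m φ) Δ) :=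
      cut hα (atR (n := k) (ax α n _ (Finset.mem_insert_self _ _) (Finset.mem_insert_self _ ∅)))
        (cut hα h₁ (ax α m φ (by simp) (by simp)) (by grind) (by grind)) subset_rfl (by simp)
    obtain ⟨_, d⟩ := h₂
    refine atR ⟨_, .frR α n m φ ?_ d⟩
    simp only [FreshNom, forall_eq_or_imp, NForm.fill, Form.noms, Finset.mem_insert,
      not_or] at hm ⊢
    tauto
  | imp ψ L ih =>
    refine impR (ih hT hα (impR_inv hα h) ?_)
    simp only [FreshNom, forall_eq_or_imp, NForm.fill, Form.noms, Finset.mem_insert,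
      Finset.mem_union, not_or] at hm ⊢
    tauto
  | atBox j L ih =>
    refine atR ?_
    obtain ⟨i, hi⟩ := exists_freshNat T Γ
      (insert (α, Form.atf j (Form.box (L.fill (Form.atf n (Form.fr φ))))) Δ)
    have ⟨_, d⟩ := ih (hT.insert_child hα j i) (Finset.mem_insert_self _ _)
      (boxR_inv hT hα (atR_inv hα h) i) (by
        have := hm.1 α hα
        simp only [FreshNom, forall_eq_or_imp, NForm.fill, Form.noms, Finset.mem_insert,
          Label.noms, not_or] at hm ⊢
        tauto)
    exact ⟨_, .boxR α j i _ hi d⟩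

end Provable

/-- Every substitution instance of a HEFL theorem is derivable at every label and nominal. -/
theorem Hil.provable_applySub {φ : Form} (hφ : Hil ∅ φ) (σp : ℕ → Form) (σn : ℕ → ℕ)
    {T : Finset Label} {α : Label} (n : ℕ) (hT : IsTree T) (hα : α ∈ T) :
    Provable true T ∅ (insert (α, Form.atf n (ApplySub σp σn φ)) ∅) := by
  induction hφ generalizing σp σn T α n with
  | extra h => exact absurd h (Set.notMem_empty _)
  | taut h => exact .of_isTaut hα (h.applySub σp σn) (ApplySub σp σn _).primes (by tauto)
  | kBox p q =>
    refine .impR (.impR (.boxR fun i => ?_))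
    refine .boxL α n i (σp p) (by simp) (by simp [ApplySub]) ?_
    refine .boxL α n i (Form.imp (σp p) (σp q)) (by simp) (by simp [ApplySub]) ?_
    exact .impL (Label.child α n i) n (σp p) (σp q) (by simp)
      (.ax (Label.child α n i) n (σp p) (by simp) (by simp))
      (.ax (Label.child α n i) n (σp q) (by simp) (by simp [ApplySub]))
  | kF p q =>
    refine .impR (.impR (.frR fun m _ => ?_))
    refine .frL α n m (σp p) (by simp [ApplySub])
      (.ax α n (Form.diaF (Form.nom m)) (by simp) (by simp)) ?_
    refine .frL α n m (Form.imp (σp p) (σp q)) (by simp [ApplySub])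
      (.ax α n (Form.diaF (Form.nom m)) (by simp) (by simp)) ?_
    exact .impL α m (σp p) (σp q) (by simp) (.ax α m (σp p) (by simp) (by simp))
      (.ax α m (σp q) (by simp) (by simp [ApplySub]))
  | kAt k p q =>
    refine .impR (.impR (.atR ?_))
    refine .atL α n (σn k) (σp p) (by simp [ApplySub]) ?_
    refine .atL α n (σn k) (Form.imp (σp p) (σp q)) (by simp [ApplySub]) ?_
    exact .impL α (σn k) (σp p) (σp q) (by simp) (.ax α (σn k) (σp p) (by simp) (by simp))
      (.ax α (σn k) (σp q) (by simp) (by simp [ApplySub]))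
  | refAx k =>
    exact .atR (.refl α (σn k) hα (.ax α (σn k) (Form.nom (σn k)) (by simp) (by simp [ApplySub])))
  | selfdual k p =>
    refine .iffR ?_ ?_ hα
    · refine .atR (.impR ?_)
      refine .impL α n (Form.atf (σn k) (σp p)) Form.bot (by simp [ApplySub, Form.neg]) ?_
        (.botL α n (by simp))
      exact .atR (.ax α (σn k) (σp p) (by simp [ApplySub]) (by simp))
    · refine .impR (.atL α n (σn k) (σp p) (by simp [ApplySub]) ?_)
      refine .atL α n (σn k) (Form.neg (σp p)) (by simp [ApplySub, Form.neg]) ?_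
      exact .impL α (σn k) (σp p) Form.bot (by simp [Form.neg])
        (.ax α (σn k) (σp p) (by simp) (by simp)) (.botL α (σn k) (by simp))
  | elim k p =>
    refine .impR (.impR (.atL α n (σn k) (σp p) (by simp [ApplySub]) ?_))
    refine .repPrefix α n (σn k) (σp p) (by simp [ApplySub]) (by simp) ?_
    exact .ax α n (σp p) (by simp) (by simp [ApplySub])
  | agree k m p =>
    refine .impR (.atL α n (σn k) (Form.atf (σn m) (σp p)) (by simp [ApplySub]) ?_)
    refine .atL α (σn k) (σn m) (σp p) (by simp) ?_
    exact .atR (.ax α (σn m) (σp p) (by simp) (by simp [ApplySub]))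
  | back k p =>
    refine .impR (.frR fun m _ => .atR ?_)
    refine .atL α n (σn k) (σp p) (by simp [ApplySub]) ?_
    exact .ax α (σn k) (σp p) (by simp) (by simp [ApplySub])
  | dcom k p =>
    refine .iffR ?_ ?_ hα
    · refine .atR (.boxR fun i => ?_)
      refine .atL α n (σn k) (Form.box (Form.atf (σn k) (σp p))) (by simp [ApplySub]) ?_
      refine .boxL α (σn k) i (Form.atf (σn k) (σp p)) (by simp) (by simp) ?_
      refine .atL _ (σn k) (σn k) (σp p) (Finset.mem_insert_self _ _) ?_
      exact .ax _ (σn k) (σp p) (Finset.mem_insert_self _ _) (by simp [ApplySub])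
    · refine .atR (.boxR fun i => .atR ?_)
      refine .atL α n (σn k) (Form.box (σp p)) (by simp [ApplySub]) ?_
      refine .boxL α (σn k) i (σp p) (by simp) (by simp) ?_
      exact .ax _ (σn k) (σp p) (Finset.mem_insert_self _ _) (by simp [ApplySub])
  | rigidEq k m =>
    refine .impR (.boxR fun i => .atR ?_)
    refine .atL α n (σn k) (Form.nom (σn m)) (by simp [ApplySub]) ?_
    refine .rigid α (Label.child α n i) (σn k) (σn m) (by simp) (by simp) ?_
    exact .ax _ (σn k) (Form.nom (σn m)) (Finset.mem_insert_self _ _) (by simp [ApplySub])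
  | rigidNeq k m =>
    refine .impR (.boxR fun i => .impR ?_)
    refine .atL (Label.child α n i) n (σn k) (Form.nom (σn m)) (by simp [ApplySub]) ?_
    refine .rigid (Label.child α n i) α (σn k) (σn m) (by simp [hα]) (by simp) ?_
    refine .impL α n (Form.atf (σn k) (Form.nom (σn m))) Form.bot (by simp [ApplySub, Form.neg]) ?_
      (.botL α n (by simp))
    exact .atR (.ax α (σn k) (Form.nom (σn m)) (by simp) (by simp))
  | mp _ _ ih₁ ih₂ =>
    exact .cut hα (ih₂ σp σn n hT hα) (.impR_inv hα (ih₁ σp σn n hT hα)) (by simp) (by simp)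
  | necBox _ ih =>
    exact .boxR fun i => ih σp σn n (hT.insert_child hα n i) (by simp)
  | necF _ ih =>
    refine .frR fun m _ => ?_
    exact .cut hα (ih σp σn m hT hα) (.ax α m _ (Finset.mem_insert_self _ _)
      (Finset.mem_insert_self _ _)) (by simp) (by simp)
  | necAt k _ ih => exact .atR (ih σp σn (σn k) hT hα)
  | us τp τn _ ih =>
    rw [ApplySub_comp]
    exact ih _ _ n hT hα
  | name k hk _ ih =>
    have h := Provable.impR_inv hα (ih σp (Function.update σn k n) n hT hα)
    rw [ApplySub_update _ _ _ _ _ hk] at h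
    exact .refl α n hα (by simpa [ApplySub] using h)
  | @lbg φ L k m hm _ ih =>
    rw [NForm.applySub_fill]
    obtain ⟨m', hm'⟩ := exists_freshNom T ∅ (insert (α, Form.atf n
      ((L.applySub σp σn).fill (ApplySub σp σn (Form.atf k (Form.fr φ))))) ∅)
    refine .fill_fr (L.applySub σp σn) m' hT hα ?_ hm'
    have h := ih σp (Function.update σn m m') n hT hα
    have hφ := NForm.notMem_noms_of_fill _ _ _ hm
    simp only [Form.noms, Finset.mem_insert, not_or] at hφ
    rw [NForm.applySub_fill, NForm.applySub_update _ _ _ _ _ _ hm] at h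
    simpa [ApplySub, Form.diaF, Form.neg, ApplySub_update _ _ _ _ _ hφ.2,
      Function.update_apply, Ne.symm hφ.1] using h

/-- HEFL-provable formulas are provable (as sequents) in TEFL. -/
theorem HEFL_to_TEFL (φ : Form) (hφ : Hil ∅ φ) :
    ∀ (T : Finset Label) (α : Label) (n : ℕ), IsTree T → α ∈ T → n ∉ Form.noms φ →
      Provable true T ∅ {(α, Form.atf n φ)} := by
  intro T α n hT hα _
  simpa [ApplySub_id] using hφ.provable_applySub Form.pv (fun n => n) n hT hα
end

section
/- Soundness and completeness of HEFL: a formula φ is valid in the class of all models (i.e., M,(w,a) ⊨ φ for every model M and every pair (w,a) of a state and an agent of M) if and only if φ is provable in the Hilbert system HEFL. -/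
set_option autoImplicit false

namespace HEFL

open Form

/-! ### Soundness -/

section Soundness
variable {W A : Type}

/-- The model `M` with nominal `m` reinterpreted as the agent `b`. -/
def rename (M : Model W A) (m : ℕ) (b : A) : Model W A :=
  { M with Vn := Function.update M.Vn m b }

theorem sat_rename (M : Model W A) (m : ℕ) (b : A) (φ : Form) (h : m ∉ noms φ) (w : W) (a : A) :
    Sat (rename M m b) w a φ ↔ Sat M w a φ := by
  induction φ generalizing w a with
  | nom n =>
    have : n ≠ m := by rintro rfl; simp [noms] at h
    simp [Sat, rename, Function.update_of_ne this]
  | pv p => rfl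
  | bot => rfl
  | imp φ ψ ih₁ ih₂ =>
    simp only [noms, Finset.mem_union, not_or] at h
    simp only [Sat, ih₁ h.1, ih₂ h.2]
  | atf n φ ih =>
    simp only [noms, Finset.mem_insert, not_or] at h
    have : (rename M m b).Vn n = M.Vn n := Function.update_of_ne (Ne.symm h.1) _ _
    simp only [Sat, ih h.2, this]
  | fr φ ih => exact forall_congr' fun c => imp_congr Iff.rfl (ih h w c)
  | box φ ih => exact forall_congr' fun v => imp_congr Iff.rfl (ih h v a)

theorem sat_applySub (M : Model W A) (σp : ℕ → Form) (σn : ℕ → ℕ) (φ : Form) (w : W) (a : A) :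
    Sat M w a (ApplySub σp σn φ) ↔
      Sat { M with Vp := fun p w a => Sat M w a (σp p), Vn := fun n => M.Vn (σn n) } w a φ := by
  induction φ generalizing w a with
  | nom n => rfl
  | pv p => rfl
  | bot => rfl
  | imp φ ψ ih₁ ih₂ => simp only [ApplySub, Sat, ih₁, ih₂]
  | atf n φ ih => simp only [ApplySub, Sat, ih]
  | fr φ ih => simp only [ApplySub, Sat, ih]
  | box φ ih => simp only [ApplySub, Sat, ih]

theorem sat_of_isTaut (M : Model W A) {φ : Form} (h : IsTaut φ) (w : W) (a : A) :
    Sat M w a φ := by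
  classical
  have := h (fun ψ => decide (Sat M w a ψ)) (decide_eq_false id)
    (fun ψ χ => by by_cases h₁ : Sat M w a ψ <;> by_cases h₂ : Sat M w a χ <;> simp [Sat, h₁, h₂])
  simpa using this

/-- A refutation of `L(@ₙFφ)` yields a refutation of `L(@ₙ⟨F⟩m → @ₘφ)` for a suitable
denotation of the fresh nominal `m`. -/
theorem exists_rename_not_sat (M : Model W A) (L : NForm) (n m : ℕ) (φ : Form)
    (hm : m ∉ noms (L.fill (atf n (fr φ)))) (w : W) (a : A)
    (h : ¬ Sat M w a (L.fill (atf n (fr φ)))) :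
    ∃ b, ¬ Sat (rename M m b) w a (L.fill (imp (atf n (diaF (nom m))) (atf m φ))) := by
  induction L generalizing w a with
  | hole =>
    simp only [NForm.fill, noms, Finset.mem_insert, not_or] at hm
    simp only [NForm.fill, Sat, not_forall] at h
    obtain ⟨b, hb, hφ⟩ := h
    refine ⟨b, fun hs => hφ ?_⟩
    have hn : (rename M m b).Vn n = M.Vn n := Function.update_of_ne (Ne.symm hm.1) _ _
    have hmb : (rename M m b).Vn m = b := Function.update_self _ _ _
    simp only [NForm.fill, Sat, diaF, neg, hn, hmb] at hs
    exact (sat_rename M m b φ hm.2 w b).1 (hs fun hf => hf b hb rfl)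
  | imp ψ L ih =>
    simp only [NForm.fill, noms, Finset.mem_union, not_or] at hm
    simp only [NForm.fill, Sat, Classical.not_imp] at h
    obtain ⟨b, hb⟩ := ih hm.2 w a h.2
    exact ⟨b, fun hs => hb (hs ((sat_rename M m b ψ hm.1 w a).2 h.1))⟩
  | atBox k L ih =>
    simp only [NForm.fill, noms, Finset.mem_insert, not_or] at hm
    simp only [NForm.fill, Sat, not_forall] at h
    obtain ⟨v, hv, hs⟩ := h
    obtain ⟨b, hb⟩ := ih hm.2 v _ hs
    refine ⟨b, fun ht => hb ?_⟩
    have hk : (rename M m b).Vn k = M.Vn k := Function.update_of_ne (Ne.symm hm.1) _ _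
    simp only [NForm.fill, Sat, hk] at ht
    exact ht v hv

theorem sound {φ : Form} (h : Hil ∅ φ) (M : Model W A) (w : W) (a : A) : Sat M w a φ := by
  induction h generalizing M w a with
  | extra h => exact h.elim
  | taut h => exact sat_of_isTaut M h w a
  | kBox p q => exact fun h₁ h₂ v hv => h₁ v hv (h₂ v hv)
  | kF p q => exact fun h₁ h₂ b hb => h₁ b hb (h₂ b hb)
  | kAt n p q => exact fun h₁ h₂ => h₁ h₂
  | refAx n => rfl
  | selfdual n p => exact fun h => h id id
  | elim n p => simp only [Sat]; rintro h rfl; exact h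
  | agree n m p => exact id
  | back n p => exact fun h _ _ => h
  | dcom n p => exact fun h => h id id
  | rigidEq n m => exact fun h _ _ => h
  | rigidNeq n m => exact fun h _ _ => h
  | mp _ _ ih₁ ih₂ => exact ih₁ M w a (ih₂ M w a)
  | necBox _ ih => exact fun v _ => ih M v a
  | necF _ ih => exact fun b _ => ih M w b
  | necAt n _ ih => exact ih M w _
  | us σp σn _ ih => exact (sat_applySub M σp σn _ w a).2 (ih _ w a)
  | name n hn _ ih =>
    exact (sat_rename M n a _ hn w a).1 (ih (rename M n a) w a (Function.update_self _ _ _))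
  | lbg L n m hm _ ih =>
    by_contra h
    obtain ⟨b, hb⟩ := exists_rename_not_sat M L n m _ hm w a h
    exact hb (ih _ w a)

end Soundness

/-! ### Instances of the axioms -/

/-- The substitution sending the variable `0` to `φ` and all others to `ψ`. -/
def pairSub (φ ψ : Form) : ℕ → Form
  | 0 => φ
  | _ + 1 => ψ

variable {φ ψ : Form} {n m : ℕ}

theorem kBox (φ ψ : Form) : Hil ∅ (imp (box (imp φ ψ)) (imp (box φ) (box ψ))) :=
  (Hil.kBox 0 1).us (pairSub φ ψ) id

theorem kF (φ ψ : Form) : Hil ∅ (imp (fr (imp φ ψ)) (imp (fr φ) (fr ψ))) :=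
  (Hil.kF 0 1).us (pairSub φ ψ) id

theorem kAt (n : ℕ) (φ ψ : Form) :
    Hil ∅ (imp (atf n (imp φ ψ)) (imp (atf n φ) (atf n ψ))) :=
  (Hil.kAt n 0 1).us (pairSub φ ψ) id

theorem selfdual (n : ℕ) (φ : Form) : Hil ∅ (Form.iff (neg (atf n φ)) (atf n (neg φ))) :=
  (Hil.selfdual n 0).us (pairSub φ φ) id

theorem elim (n : ℕ) (φ : Form) : Hil ∅ (imp (atf n φ) (imp (nom n) φ)) :=
  (Hil.elim n 0).us (pairSub φ φ) id

theorem agree (n m : ℕ) (φ : Form) : Hil ∅ (imp (atf n (atf m φ)) (atf m φ)) :=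
  (Hil.agree n m 0).us (pairSub φ φ) id

theorem back (n : ℕ) (φ : Form) : Hil ∅ (imp (atf n φ) (fr (atf n φ))) :=
  (Hil.back n 0).us (pairSub φ φ) id

theorem dcom (n : ℕ) (φ : Form) :
    Hil ∅ (Form.iff (atf n (box (atf n φ))) (atf n (box φ))) :=
  (Hil.dcom n 0).us (pairSub φ φ) id

/-! ### Theories -/

/-- Sets of formulas containing the theorems and closed under modus ponens and the infinitary
version of the rule L(BG). -/
structure IsTheory (Γ : Set Form) : Prop where
  thm : ∀ {φ}, Hil ∅ φ → φ ∈ Γ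
  mp : ∀ {φ ψ}, imp φ ψ ∈ Γ → φ ∈ Γ → ψ ∈ Γ
  bg : ∀ (L : NForm) (n : ℕ) (φ : Form),
    (∀ m, L.fill (imp (atf n (diaF (nom m))) (atf m φ)) ∈ Γ) → L.fill (atf n (fr φ)) ∈ Γ

/-- Consistent theories that decide every formula. -/
structure IsComplete (Γ : Set Form) : Prop extends IsTheory Γ where
  cons : bot ∉ Γ
  total : ∀ φ, φ ∈ Γ ∨ neg φ ∈ Γ

theorem isTheory_theorems : IsTheory {φ | Hil ∅ φ} where
  thm := id
  mp := Hil.mp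
  bg L n φ h :=
    let ⟨m, hm⟩ := Infinite.exists_notMem_finset (noms (L.fill (atf n (fr φ))))
    Hil.lbg L n m hm (h m)

namespace IsTheory
variable {Γ : Set Form}

theorem taut (h : IsTheory Γ) (ht : IsTaut φ) : φ ∈ Γ := h.thm (.taut ht)

theorem adjoin (h : IsTheory Γ) (ψ : Form) : IsTheory {φ | imp ψ φ ∈ Γ} where
  thm {φ} hφ := h.mp (h.taut (φ := imp φ (imp ψ φ)) fun v hb hi => by
    simp only [hi]; cases v φ <;> cases v ψ <;> rfl) (h.thm hφ)
  mp {φ χ} h₁ h₂ := h.mp (h.mp (h.taut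
    (φ := imp (imp ψ (imp φ χ)) (imp (imp ψ φ) (imp ψ χ))) fun v hb hi => by
      simp only [hi]; cases v φ <;> cases v ψ <;> cases v χ <;> rfl) h₁) h₂
  bg L n φ hL := h.bg (.imp ψ L) n φ hL

theorem subset_adjoin (h : IsTheory Γ) (ψ : Form) : Γ ⊆ {φ | imp ψ φ ∈ Γ} := fun φ hφ =>
  h.mp (h.taut (φ := imp φ (imp ψ φ)) fun v hb hi => by
    simp only [hi]; cases v φ <;> cases v ψ <;> rfl) hφ

theorem mem_adjoin (h : IsTheory Γ) (ψ : Form) : ψ ∈ {φ | imp ψ φ ∈ Γ} :=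
  h.taut (φ := imp ψ ψ) fun v hb hi => by simp only [hi]; cases v ψ <;> rfl

theorem bot_notMem_adjoin_neg (h : IsTheory Γ) (hψ : ψ ∉ Γ) :
    bot ∉ {φ | imp (neg ψ) φ ∈ Γ} := fun hb =>
  hψ (h.mp (h.taut (φ := imp (imp (neg ψ) bot) ψ) fun v hb hi => by
    simp only [neg, hi, hb]; cases v ψ <;> rfl) hb)

theorem box (h : IsTheory Γ) (n : ℕ) : IsTheory {φ | atf n (box φ) ∈ Γ} where
  thm hφ := h.thm (.necAt n (.necBox hφ))
  mp h₁ h₂ := h.mp (h.mp (h.thm (kAt n _ _)) (h.mp (h.mp (h.thm (kAt n _ _))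
    (h.thm (.necAt n (kBox _ _)))) h₁)) h₂
  bg L k φ hL := h.bg (.atBox n L) k φ hL

end IsTheory

/-! ### Extension to complete theories -/

/-- An injective numbering of formulas. -/
def formCode : Form → ℕ
  | .nom n => Nat.pair 0 n
  | .pv p => Nat.pair 1 p
  | .bot => Nat.pair 2 0
  | .imp φ ψ => Nat.pair 3 (Nat.pair (formCode φ) (formCode ψ))
  | .atf n φ => Nat.pair 4 (Nat.pair n (formCode φ))
  | .fr φ => Nat.pair 5 (formCode φ)
  | .box φ => Nat.pair 6 (formCode φ)

theorem formCode_injective : Function.Injective formCode := by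
  intro φ
  induction φ <;> intro ψ <;> cases ψ <;> simp [formCode, Nat.pair_eq_pair] <;> grind

/-- An injective numbering of necessity forms. -/
def nformCode : NForm → ℕ
  | .hole => Nat.pair 0 0
  | .imp φ L => Nat.pair 1 (Nat.pair (formCode φ) (nformCode L))
  | .atBox n L => Nat.pair 2 (Nat.pair n (nformCode L))

theorem nformCode_injective : Function.Injective nformCode := by
  intro L
  induction L <;> intro K <;> cases K <;>
    simp [nformCode, Nat.pair_eq_pair, formCode_injective.eq_iff] <;> grind

instance : Countable Form := formCode_injective.countable

instance : Countable NForm := nformCode_injective.countable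

/-- The consistent theories, ordered by inclusion. -/
abbrev ConsTheory : Type := {Γ : Set Form // IsTheory Γ ∧ bot ∉ Γ}

/-- The consistent theories deciding a given formula are cofinal. -/
def decides (φ : Form) : Order.Cofinal ConsTheory where
  carrier := {Γ | φ ∈ Γ.1 ∨ neg φ ∈ Γ.1}
  isCofinal Γ := by
    by_cases h : φ ∈ Γ.1
    · exact ⟨Γ, .inl h, le_rfl⟩
    · exact ⟨⟨_, Γ.2.1.adjoin (neg φ), Γ.2.1.bot_notMem_adjoin_neg h⟩,
        .inr (Γ.2.1.mem_adjoin _), Γ.2.1.subset_adjoin _⟩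

/-- The consistent theories containing a given `L(@ₙFφ)` or a witness against it are cofinal. -/
def witnesses (L : NForm) (n : ℕ) (φ : Form) : Order.Cofinal ConsTheory where
  carrier := {Γ | L.fill (atf n (fr φ)) ∈ Γ.1 ∨
    ∃ m, neg (L.fill (imp (atf n (diaF (nom m))) (atf m φ))) ∈ Γ.1}
  isCofinal Γ := by
    by_cases h : ∀ m, L.fill (imp (atf n (diaF (nom m))) (atf m φ)) ∈ Γ.1
    · exact ⟨Γ, .inl (Γ.2.1.bg L n φ h), le_rfl⟩
    · obtain ⟨m, hm⟩ := not_forall.1 h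
      exact ⟨⟨_, Γ.2.1.adjoin _, Γ.2.1.bot_notMem_adjoin_neg hm⟩,
        .inr ⟨m, Γ.2.1.mem_adjoin _⟩, Γ.2.1.subset_adjoin _⟩

theorem IsTheory.exists_isComplete {Γ : Set Form} (h : IsTheory Γ) (hφ : φ ∉ Γ) :
    ∃ Δ, IsComplete Δ ∧ Γ ⊆ Δ ∧ φ ∉ Δ := by
  let Γ₀ : ConsTheory := ⟨_, h.adjoin (neg φ), h.bot_notMem_adjoin_neg hφ⟩
  let D : Form ⊕ (NForm × ℕ × Form) → Order.Cofinal ConsTheory :=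
    Sum.elim decides fun t => witnesses t.1 t.2.1 t.2.2
  have := Encodable.ofCountable (Form ⊕ (NForm × ℕ × Form))
  let I := Order.idealOfCofinals Γ₀ D
  let Δ : Set Form := {φ | ∃ Θ ∈ I, φ ∈ Θ.1}
  have hΔ : ∀ Θ ∈ I, Θ.1 ⊆ Δ := fun Θ hΘ φ hφ => ⟨Θ, hΘ, hφ⟩
  have hΓ₀ : Γ₀ ∈ I := Order.mem_idealOfCofinals Γ₀ D
  have hcons : bot ∉ Δ := fun ⟨Θ, _, hb⟩ => Θ.2.2 hb
  have hmp : ∀ {φ ψ}, imp φ ψ ∈ Δ → φ ∈ Δ → ψ ∈ Δ := by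
    rintro φ ψ ⟨Θ₁, h₁, hi⟩ ⟨Θ₂, h₂, hφ⟩
    obtain ⟨Θ, hΘ, hle₁, hle₂⟩ := I.directed Θ₁ h₁ Θ₂ h₂
    exact ⟨Θ, hΘ, Θ.2.1.mp (hle₁ hi) (hle₂ hφ)⟩
  refine ⟨Δ, ⟨⟨fun hφ => ⟨Γ₀, hΓ₀, Γ₀.2.1.thm hφ⟩, hmp, fun L n ψ hL => ?_⟩, hcons, fun ψ => ?_⟩,
    fun ψ hψ => hΔ Γ₀ hΓ₀ (h.subset_adjoin _ hψ), fun hφΔ =>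
      hcons (hmp (hΔ Γ₀ hΓ₀ (h.mem_adjoin (neg φ))) hφΔ)⟩
  · obtain ⟨Θ, hD, hΘ⟩ := Order.cofinal_meets_idealOfCofinals Γ₀ D (.inr (L, n, ψ))
    rcases hD with hD | ⟨m, hm⟩
    · exact hΔ Θ hΘ hD
    · exact (hcons (hmp (hΔ Θ hΘ hm) (hL m))).elim
  · obtain ⟨Θ, hD, hΘ⟩ := Order.cofinal_meets_idealOfCofinals Γ₀ D (.inl ψ)
    exact hD.imp (fun h => hΔ Θ hΘ h) fun h => hΔ Θ hΘ h

/-! ### Membership in complete theories -/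

namespace IsComplete
variable {w : Set Form}

theorem mem_neg (h : IsComplete w) : neg φ ∈ w ↔ φ ∉ w :=
  ⟨fun hn hφ => h.cons (h.mp hn hφ), (h.total φ).resolve_left⟩

theorem mem_imp (h : IsComplete w) : imp φ ψ ∈ w ↔ (φ ∈ w → ψ ∈ w) := by
  refine ⟨h.mp, fun hi => ?_⟩
  by_cases hφ : φ ∈ w
  · exact h.mp (h.taut (φ := imp ψ (imp φ ψ)) fun v hb hi => by
      simp only [hi]; cases v φ <;> cases v ψ <;> rfl) (hi hφ)
  · exact h.mp (h.taut (φ := imp (neg φ) (imp φ ψ)) fun v hb hi => by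
      simp only [neg, hi, hb]; cases v φ <;> cases v ψ <;> rfl) (h.mem_neg.2 hφ)

theorem mem_iff (h : IsComplete w) : Form.iff φ ψ ∈ w ↔ (φ ∈ w ↔ ψ ∈ w) := by
  simp only [Form.iff, Form.and, h.mem_neg, h.mem_imp]
  tauto

end IsComplete

theorem hil_of_forall_isComplete (h : ∀ w, IsComplete w → φ ∈ w) : Hil ∅ φ := by
  by_contra hφ
  obtain ⟨w, hw, -, hn⟩ := isTheory_theorems.exists_isComplete (φ := φ) hφ
  exact hn (h w hw)

namespace IsComplete
variable {w : Set Form}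

theorem mem_atf_neg (h : IsComplete w) : atf n (neg φ) ∈ w ↔ atf n φ ∉ w := by
  rw [← h.mem_neg]
  exact (h.mem_iff.1 (h.thm (selfdual n φ))).symm

theorem atf_mp (h : IsComplete w) (hi : atf n (imp φ ψ) ∈ w) (hφ : atf n φ ∈ w) :
    atf n ψ ∈ w :=
  h.mp (h.mp (h.thm (kAt n φ ψ)) hi) hφ

theorem atf_thm (h : IsComplete w) (hφ : Hil ∅ φ) : atf n φ ∈ w := h.thm (.necAt n hφ)

theorem atf_bot_notMem (h : IsComplete w) : atf n bot ∉ w :=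
  h.mem_atf_neg.1 (h.atf_thm (.taut fun v hb hi => by simp only [neg, hi, hb]; rfl))

theorem mem_atf_imp (h : IsComplete w) :
    atf n (imp φ ψ) ∈ w ↔ (atf n φ ∈ w → atf n ψ ∈ w) := by
  refine ⟨h.atf_mp, fun hi => ?_⟩
  by_cases hφ : atf n φ ∈ w
  · exact h.atf_mp (h.atf_thm (.taut (φ := imp ψ (imp φ ψ)) fun v hb hi => by
      simp only [hi]; cases v φ <;> cases v ψ <;> rfl)) (hi hφ)
  · exact h.atf_mp (h.atf_thm (.taut (φ := imp (neg φ) (imp φ ψ)) fun v hb hi => by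
      simp only [neg, hi, hb]; cases v φ <;> cases v ψ <;> rfl)) (h.mem_atf_neg.2 hφ)

theorem mem_atf_atf (h : IsComplete w) : atf n (atf m φ) ∈ w ↔ atf m φ ∈ w := by
  refine ⟨h.mp (h.thm (agree n m φ)), fun hφ => ?_⟩
  by_contra hn
  rw [← h.mem_atf_neg] at hn
  refine h.mem_atf_neg.1 (h.mp (h.thm (agree n m (neg φ))) (h.atf_mp (h.atf_thm ?_) hn)) hφ
  exact hil_of_forall_isComplete fun v hv => by
    simp only [hv.mem_imp, hv.mem_neg, hv.mem_atf_neg, imp_self]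

theorem mem_atf_box_atf (h : IsComplete w) :
    atf n (box (atf n φ)) ∈ w ↔ atf n (box φ) ∈ w :=
  h.mem_iff.1 (h.thm (dcom n φ))

end IsComplete

theorem nom_intro (m : ℕ) (φ : Form) : Hil ∅ (imp (nom m) (imp φ (atf m φ))) := by
  refine hil_of_forall_isComplete fun w hw => ?_
  have := hw.thm (elim m (neg φ))
  simp only [hw.mem_imp, hw.mem_neg, hw.mem_atf_neg] at this ⊢
  tauto

theorem bridge (m : ℕ) (φ : Form) :
    Hil ∅ (imp (fr φ) (imp (diaF (nom m)) (atf m φ))) := by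
  have hF : Hil ∅ (fr (imp φ (imp (atf m (neg φ)) (neg (nom m))))) :=
    .necF <| hil_of_forall_isComplete fun w hw => by
      have := hw.thm (nom_intro m φ)
      simp only [hw.mem_imp, hw.mem_neg, hw.mem_atf_neg] at this ⊢
      tauto
  refine hil_of_forall_isComplete fun w hw => ?_
  rw [hw.mem_imp, hw.mem_imp, diaF, hw.mem_neg]
  refine fun hφ hd => of_not_not fun hn => hd ?_
  have h₁ := hw.mp (hw.mp (hw.thm (kF _ _)) (hw.thm hF)) hφ
  exact hw.mp (hw.mp (hw.thm (kF _ _)) h₁)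
    (hw.mp (hw.thm (back m (neg φ))) (hw.mem_atf_neg.2 hn))

namespace IsComplete
variable {w : Set Form} {k : ℕ}

theorem atf_nom_self (h : IsComplete w) (n : ℕ) : atf n (nom n) ∈ w := h.thm (.refAx n)

theorem atf_congr_right (h : IsComplete w) (hm : atf n (nom m) ∈ w) (hφ : atf n φ ∈ w) :
    atf m φ ∈ w :=
  h.mem_atf_atf.1 (h.atf_mp (h.atf_mp (h.atf_thm (nom_intro m φ)) hm) hφ)

theorem atf_nom_symm (h : IsComplete w) (hm : atf n (nom m) ∈ w) : atf m (nom n) ∈ w :=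
  h.atf_congr_right hm (h.atf_nom_self n)

theorem atf_congr (h : IsComplete w) (hm : atf n (nom m) ∈ w) :
    atf n φ ∈ w ↔ atf m φ ∈ w :=
  ⟨h.atf_congr_right hm, h.atf_congr_right (h.atf_nom_symm hm)⟩

theorem mem_atf_fr (h : IsComplete w) :
    atf n (fr φ) ∈ w ↔ ∀ m, atf n (diaF (nom m)) ∈ w → atf m φ ∈ w :=
  ⟨fun hφ m hm => h.mem_atf_atf.1 (h.atf_mp (h.atf_mp (h.atf_thm (bridge m φ)) hφ) hm),
    fun hm => h.bg .hole n φ fun m => h.mem_imp.2 (hm m)⟩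

theorem exists_of_atf_box_notMem (h : IsComplete w) (hφ : atf n (box φ) ∉ w) :
    ∃ v, IsComplete v ∧ {ψ | atf n (box ψ) ∈ w} ⊆ v ∧ atf n φ ∉ v :=
  (h.box n).exists_isComplete fun hn => hφ (h.mem_atf_box_atf.1 hn)

theorem atf_box_atf_nom (h : IsComplete w) (hm : atf n (nom m) ∈ w) :
    atf k (box (atf n (nom m))) ∈ w :=
  h.atf_mp (h.atf_thm (.rigidEq n m)) (h.mem_atf_atf.2 hm)

theorem atf_box_neg_atf_nom (h : IsComplete w) (hm : atf n (nom m) ∉ w) :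
    atf k (box (neg (atf n (nom m)))) ∈ w :=
  h.atf_mp (h.atf_thm (.rigidNeq n m)) (h.mem_atf_neg.2 fun hn => hm (h.mem_atf_atf.1 hn))

end IsComplete

/-! ### The canonical model -/

section Canonical
variable {w₀ : Set Form}

/-- Two nominals are identified when `w₀` declares them equal. -/
def nomSetoid (h₀ : IsComplete w₀) : Setoid ℕ where
  r n m := atf n (nom m) ∈ w₀
  iseqv :=
    { refl := h₀.atf_nom_self
      symm := h₀.atf_nom_symm
      trans := fun h₁ h₂ => (h₀.atf_congr h₁).2 h₂ }

/-- The states of the canonical model: the complete theories agreeing with `w₀` on the identity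
of nominals. -/
abbrev CanonState (w₀ : Set Form) : Type :=
  {w : Set Form // IsComplete w ∧ ∀ n m, atf n (nom m) ∈ w ↔ atf n (nom m) ∈ w₀}

/-- The canonical model of the complete theory `w₀`. -/
noncomputable def canonModel (h₀ : IsComplete w₀) :
    Model (CanonState w₀) (Quotient (nomSetoid h₀)) where
  wne := ⟨⟨w₀, h₀, fun _ _ => Iff.rfl⟩⟩
  ane := ⟨Quotient.mk _ 0⟩
  R a w v := ∀ ψ, atf a.out (box ψ) ∈ w.1 → atf a.out ψ ∈ v.1
  friend w a b := ∃ k, Quotient.mk _ k = b ∧ atf a.out (diaF (nom k)) ∈ w.1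
  Vp p w a := atf a.out (pv p) ∈ w.1
  Vn n := Quotient.mk _ n

theorem atf_out_mem (h₀ : IsComplete w₀) (w : CanonState w₀) (n : ℕ) :
    atf (Quotient.mk (nomSetoid h₀) n).out φ ∈ w.1 ↔ atf n φ ∈ w.1 :=
  w.2.1.atf_congr <| (w.2.2 _ _).2 <| Quotient.exact (s := nomSetoid h₀) (Quotient.out_eq _)

theorem sat_canonModel (h₀ : IsComplete w₀) (φ : Form) (w : CanonState w₀)
    (a : Quotient (nomSetoid h₀)) :
    Sat (canonModel h₀) w a φ ↔ atf a.out φ ∈ w.1 := by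
  induction φ generalizing w a with
  | nom n =>
    calc Quotient.mk _ n = a ↔ Quotient.mk (nomSetoid h₀) a.out = Quotient.mk _ n := by
          rw [Quotient.out_eq, eq_comm]
      _ ↔ atf a.out (nom n) ∈ w₀ := Quotient.eq
      _ ↔ _ := (w.2.2 _ _).symm
  | pv p => exact Iff.rfl
  | bot => exact iff_of_false id w.2.1.atf_bot_notMem
  | imp φ ψ ih₁ ih₂ => rw [w.2.1.mem_atf_imp, ← ih₁, ← ih₂, Sat]
  | atf n φ ih => rw [Sat, ih, w.2.1.mem_atf_atf]; exact atf_out_mem h₀ w n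
  | fr φ ih =>
    rw [w.2.1.mem_atf_fr]
    constructor
    · exact fun hs m hm => (atf_out_mem h₀ w m).1 ((ih _ _).1 (hs _ ⟨m, rfl, hm⟩))
    · rintro hφ _ ⟨k, rfl, hk⟩
      exact (ih _ _).2 ((atf_out_mem h₀ w k).2 (hφ k hk))
  | box φ ih =>
    constructor
    · intro hs
      by_contra hn
      obtain ⟨v, hv, hwv, hφ⟩ := w.2.1.exists_of_atf_box_notMem hn
      have hrigid : ∀ n m, atf n (nom m) ∈ v ↔ atf n (nom m) ∈ w₀ := fun n m => by
        rw [← w.2.2]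
        exact ⟨not_imp_not.1 fun h => hv.mem_neg.1 (hwv (w.2.1.atf_box_neg_atf_nom h)),
          fun h => hwv (w.2.1.atf_box_atf_nom h)⟩
      exact hφ ((ih ⟨v, hv, hrigid⟩ a).1
        (hs _ fun ψ hψ => hwv (w.2.1.mem_atf_box_atf.2 hψ)))
    · exact fun hφ v hv => (ih v a).2 (hv φ hφ)

end Canonical

theorem complete (h : ∀ (W A : Type) (M : Model W A) (w : W) (a : A), Sat M w a φ) :
    Hil ∅ φ := by
  obtain ⟨n, hn⟩ := Infinite.exists_notMem_finset (noms φ)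
  refine .name n hn (.mp (elim n φ) ?_)
  by_contra hφ
  obtain ⟨w₀, h₀, -, hw₀⟩ := isTheory_theorems.exists_isComplete (φ := atf n φ) hφ
  let w : CanonState w₀ := ⟨w₀, h₀, fun _ _ => Iff.rfl⟩
  exact hw₀ ((atf_out_mem h₀ w n).1 ((sat_canonModel h₀ φ w _).1 (h _ _ _ _ _)))

end HEFL

/-- soundness and completeness of HEFL with respect to the class
    of all models. -/
theorem HEFL_sound_complete (φ : Form) :
    (∀ (W A : Type) (M : Model W A) (w : W) (a : A), Sat M w a φ) ↔ Hil ∅ φ :=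
  ⟨HEFL.complete, fun h _ _ => HEFL.sound h⟩
end

section
/- Let Λ be either S4 := {□p→p, □p→□□p} or S5 := S4 ∪ {p→□¬□¬p}, and let Θ be a possibly empty finite set of regular implications. Then for every formula φ, φ is valid in the class M_{Λ∪Θ} of all models whose frame validates Λ∪Θ if and only if φ is provable in the Hilbert system HEFL(Λ∪Θ), the axiomatic extension of HEFL by the formulas in Λ∪Θ as additional axioms. -/
set_option autoImplicit false

/-- An injective coding of formulas by natural numbers. -/
def Form.code : Form → ℕ
  | .nom n => Nat.pair 0 n
  | .pv p => Nat.pair 1 p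
  | .bot => Nat.pair 2 0
  | .imp φ ψ => Nat.pair 3 (Nat.pair φ.code ψ.code)
  | .atf n φ => Nat.pair 4 (Nat.pair n φ.code)
  | .fr φ => Nat.pair 5 φ.code
  | .box φ => Nat.pair 6 φ.code

theorem Form.code_injective : Function.Injective Form.code := by
  intro φ
  induction φ <;> intro ψ h <;> cases ψ <;> simp_all [Form.code, Nat.pair_eq_pair] <;> grind

instance : Countable Form := Form.code_injective.countable

/-- An injective coding of necessity forms by natural numbers. -/
def NForm.code : NForm → ℕ
  | .hole => Nat.pair 0 0
  | .imp ψ L => Nat.pair 1 (Nat.pair ψ.code L.code)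
  | .atBox n L => Nat.pair 2 (Nat.pair n L.code)

theorem NForm.code_injective : Function.Injective NForm.code := by
  intro K
  induction K <;> intro L h <;> cases L <;>
    simp_all [NForm.code, Nat.pair_eq_pair, Form.code_injective.eq_iff] <;> grind

instance : Countable NForm := NForm.code_injective.countable

/-! ### Soundness -/

section Soundness
variable {W A : Type}

theorem sat_neg (M : Model W A) (w : W) (a : A) (φ : Form) :
    Sat M w a φ.neg ↔ ¬ Sat M w a φ := Iff.rfl

theorem sat_and (M : Model W A) (w : W) (a : A) (φ ψ : Form) :
    Sat M w a (φ.and ψ) ↔ Sat M w a φ ∧ Sat M w a ψ := by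
  simp only [Form.and, sat_neg, Sat]; tauto

theorem sat_or (M : Model W A) (w : W) (a : A) (φ ψ : Form) :
    Sat M w a (φ.or ψ) ↔ Sat M w a φ ∨ Sat M w a ψ := by
  simp only [Form.or, sat_neg, Sat]; tauto

theorem sat_iff (M : Model W A) (w : W) (a : A) (φ ψ : Form) :
    Sat M w a (φ.iff ψ) ↔ (Sat M w a φ ↔ Sat M w a ψ) := by
  simp only [Form.iff, sat_and, Sat]; tauto

theorem sat_diaF_nom (M : Model W A) (w : W) (a : A) (m : ℕ) :
    Sat M w a (Form.nom m).diaF ↔ M.friend w a (M.Vn m) := by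
  simp [Form.diaF, Form.neg, Sat]

theorem sat_conjList (M : Model W A) (w : W) (a : A) (l : List Form) :
    Sat M w a (conjList l) ↔ ∀ ρ ∈ l, Sat M w a ρ := by
  induction l with
  | nil => simp [conjList, Form.top, Form.neg, Sat]
  | cons φ l ih => simp [conjList, sat_and, ih]

theorem sat_disjList (M : Model W A) (w : W) (a : A) (l : List Form) :
    Sat M w a (disjList l) ↔ ∃ ρ ∈ l, Sat M w a ρ := by
  induction l with
  | nil => simp [disjList, Sat]
  | cons φ l ih => simp [disjList, sat_or, ih]

theorem sat_applySub (M : Model W A) (σp : ℕ → Form) (σn : ℕ → ℕ) (φ : Form) :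
    ∀ (w : W) (a : A), Sat M w a (ApplySub σp σn φ) ↔
      Sat { toFrame := M.toFrame, Vp := fun p w a => Sat M w a (σp p), Vn := M.Vn ∘ σn } w a φ := by
  induction φ with
  | nom n => intro w a; rfl
  | pv p => intro w a; rfl
  | bot => intro w a; rfl
  | imp φ ψ ih₁ ih₂ => intro w a; exact imp_congr (ih₁ w a) (ih₂ w a)
  | atf n φ ih => intro w a; exact ih w _
  | fr φ ih => intro w a; exact forall_congr' fun b => imp_congr_right fun _ => ih w b
  | box φ ih => intro w a; exact forall_congr' fun v => imp_congr_right fun _ => ih v a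

theorem sat_update (F : Frame W A) (Vp : ℕ → W → A → Prop) (Vn : ℕ → A) (m : ℕ) (b : A)
    (φ : Form) (hm : m ∉ φ.noms) : ∀ (w : W) (a : A),
    Sat { toFrame := F, Vp := Vp, Vn := Function.update Vn m b } w a φ ↔
      Sat { toFrame := F, Vp := Vp, Vn := Vn } w a φ := by
  induction φ with
  | nom n =>
    intro w a
    have hn : n ≠ m := by rintro rfl; simp [Form.noms] at hm
    simp [Sat, hn]
  | pv p => intro w a; rfl
  | bot => intro w a; rfl
  | imp φ ψ ih₁ ih₂ =>
    intro w a
    simp only [Form.noms, Finset.mem_union, not_or] at hm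
    exact imp_congr (ih₁ hm.1 w a) (ih₂ hm.2 w a)
  | atf n φ ih =>
    intro w a
    simp only [Form.noms, Finset.mem_insert, not_or] at hm
    simp only [Sat, Function.update_of_ne (Ne.symm hm.1)]
    exact ih hm.2 w _
  | fr φ ih => intro w a; exact forall_congr' fun b => imp_congr_right fun _ => ih hm w b
  | box φ ih => intro w a; exact forall_congr' fun v => imp_congr_right fun _ => ih hm v a

/-- The premise `@ₙ⟨F⟩m → @ₘφ` of the rule BG. -/
def Form.bgPremise (n m : ℕ) (φ : Form) : Form :=
  Form.imp (Form.atf n (Form.diaF (Form.nom m))) (Form.atf m φ)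

theorem sat_fill_of_forall_update (F : Frame W A) (Vp : ℕ → W → A → Prop) (Vn : ℕ → A)
    (n m : ℕ) (φ : Form) (L : NForm) (hm : m ∉ (L.fill (Form.atf n (Form.fr φ))).noms) :
    ∀ (w : W) (a : A),
    (∀ b, Sat { toFrame := F, Vp := Vp, Vn := Function.update Vn m b } w a
      (L.fill (Form.bgPremise n m φ))) →
    Sat { toFrame := F, Vp := Vp, Vn := Vn } w a (L.fill (Form.atf n (Form.fr φ))) := by
  induction L with
  | hole =>
    intro w a h b hb
    simp only [NForm.fill, Form.noms, Finset.mem_insert, not_or] at hm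
    have := h b
    simp only [NForm.fill, Form.bgPremise, Sat, sat_diaF_nom, Function.update_self,
      Function.update_of_ne (Ne.symm hm.1)] at this
    exact (sat_update F Vp Vn m b φ hm.2 w b).1 (this hb)
  | imp ψ L ih =>
    intro w a h hψ
    simp only [NForm.fill, Form.noms, Finset.mem_union, not_or] at hm
    exact ih hm.2 w a fun b => h b ((sat_update F Vp Vn m b ψ hm.1 w a).2 hψ)
  | atBox k L ih =>
    intro w a h v hv
    simp only [NForm.fill, Form.noms, Finset.mem_insert, not_or] at hm
    refine ih hm.2 v _ fun b => ?_
    have := h b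
    simp only [NForm.fill, Sat, Function.update_of_ne (Ne.symm hm.1)] at this
    exact this v hv

theorem IsTaut.sat {φ : Form} (h : IsTaut φ) (M : Model W A) (w : W) (a : A) : Sat M w a φ := by
  classical
  have := h (fun ψ => decide (Sat M w a ψ)) (decide_eq_false id)
    (fun ψ χ => by by_cases h₁ : Sat M w a ψ <;> by_cases h₂ : Sat M w a χ <;> simp [Sat, h₁, h₂])
  simpa using this

theorem Hil.frameValid {ax : Set Form} {F : Frame W A} (hF : ∀ ψ ∈ ax, FrameValid F ψ) {φ : Form}
    (h : Hil ax φ) : FrameValid F φ := by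
  induction h with
  | extra h => exact hF _ h
  | taut h => intro Vp Vn w a; exact h.sat _ w a
  | kBox p q => intro Vp Vn w a h₁ h₂ v hv; exact h₁ v hv (h₂ v hv)
  | kF p q => intro Vp Vn w a h₁ h₂ v hv; exact h₁ v hv (h₂ v hv)
  | kAt n p q => intro Vp Vn w a h₁ h₂; exact h₁ h₂
  | refAx n => intro Vp Vn w a; rfl
  | selfdual n p => intro Vp Vn w a; rw [sat_iff]; rfl
  | elim n p => intro Vp Vn w a h₁ h₂; cases h₂; exact h₁
  | agree n m p => intro Vp Vn w a h₁; exact h₁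
  | back n p => intro Vp Vn w a h₁ b _; exact h₁
  | dcom n p => intro Vp Vn w a; rw [sat_iff]; rfl
  | rigidEq n m => intro Vp Vn w a h v _; exact h
  | rigidNeq n m => intro Vp Vn w a h v _; exact h
  | mp _ _ ih₁ ih₂ => intro Vp Vn w a; exact ih₁ Vp Vn w a (ih₂ Vp Vn w a)
  | necBox _ ih => intro Vp Vn w a v _; exact ih Vp Vn v a
  | necF _ ih => intro Vp Vn w a b _; exact ih Vp Vn w b
  | necAt n _ ih => intro Vp Vn w a; exact ih Vp Vn w _
  | us σp σn _ ih => intro Vp Vn w a; exact (sat_applySub _ σp σn _ w a).2 (ih _ _ w a)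
  | name n hn _ ih =>
    intro Vp Vn w a
    exact (sat_update F Vp Vn n a _ hn w a).1 (ih _ _ w a (Function.update_self ..))
  | lbg L n m hm _ ih =>
    intro Vp Vn w a
    exact sat_fill_of_forall_update F Vp Vn n m _ L hm w a fun b => ih _ _ w a

end Soundness

/-! ### Schematic forms of the axioms -/

namespace Hil
variable {ax : Set Form}

/-- The substitution sending the propositional variable `0` to `φ` and all others to `ψ`. -/
def pairSub (φ ψ : Form) : ℕ → Form
  | 0 => φ
  | _ + 1 => ψ

theorem box_imp (φ ψ : Form) : Hil ax ((φ.imp ψ).box.imp (φ.box.imp ψ.box)) :=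
  (Hil.kBox 0 1).us (pairSub φ ψ) id

theorem fr_imp (φ ψ : Form) : Hil ax ((φ.imp ψ).fr.imp (φ.fr.imp ψ.fr)) :=
  (Hil.kF 0 1).us (pairSub φ ψ) id

theorem atf_imp (n : ℕ) (φ ψ : Form) :
    Hil ax ((Form.atf n (φ.imp ψ)).imp ((Form.atf n φ).imp (Form.atf n ψ))) :=
  (Hil.kAt n 0 1).us (pairSub φ ψ) id

theorem atf_neg (n : ℕ) (φ : Form) :
    Hil ax ((Form.atf n φ).neg.iff (Form.atf n φ.neg)) :=
  (Hil.selfdual n 0).us (pairSub φ φ) id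

theorem atf_elim (n : ℕ) (φ : Form) : Hil ax ((Form.atf n φ).imp ((Form.nom n).imp φ)) :=
  (Hil.elim n 0).us (pairSub φ φ) id

theorem atf_agree (n m : ℕ) (φ : Form) :
    Hil ax ((Form.atf n (Form.atf m φ)).imp (Form.atf m φ)) :=
  (Hil.agree n m 0).us (pairSub φ φ) id

theorem atf_back (n : ℕ) (φ : Form) : Hil ax ((Form.atf n φ).imp (Form.atf n φ).fr) :=
  (Hil.back n 0).us (pairSub φ φ) id

theorem atf_dcom (n : ℕ) (φ : Form) :
    Hil ax ((Form.atf n (Form.atf n φ).box).iff (Form.atf n φ.box)) :=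
  (Hil.dcom n 0).us (pairSub φ φ) id

theorem iff_mp {φ ψ : Form} (h : Hil ax (φ.iff ψ)) : Hil ax (φ.imp ψ) := by
  refine .mp (.taut ?_) h
  intro v hb hi
  simp only [Form.iff, Form.and, Form.neg, hi, hb]
  cases v φ <;> cases v ψ <;> rfl

theorem iff_mpr {φ ψ : Form} (h : Hil ax (φ.iff ψ)) : Hil ax (ψ.imp φ) := by
  refine .mp (.taut ?_) h
  intro v hb hi
  simp only [Form.iff, Form.and, Form.neg, hi, hb]
  cases v φ <;> cases v ψ <;> rfl

theorem imp_self (φ : Form) : Hil ax (φ.imp φ) := by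
  refine .taut fun v hb hi => ?_
  simp only [hi]
  cases v φ <;> rfl

theorem imp_intro (φ ψ : Form) : Hil ax (φ.imp (ψ.imp φ)) := by
  refine .taut fun v hb hi => ?_
  simp only [hi]
  cases v φ <;> cases v ψ <;> rfl

theorem imp_distrib (φ ψ χ : Form) :
    Hil ax ((φ.imp (ψ.imp χ)).imp ((φ.imp ψ).imp (φ.imp χ))) := by
  refine .taut fun v hb hi => ?_
  simp only [hi]
  cases v φ <;> cases v ψ <;> cases v χ <;> rfl

theorem neg_imp (φ ψ : Form) : Hil ax (φ.neg.imp (φ.imp ψ)) := by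
  refine .taut fun v hb hi => ?_
  simp only [Form.neg, hi, hb]
  cases v φ <;> cases v ψ <;> rfl

theorem of_neg_neg (φ : Form) : Hil ax (φ.neg.neg.imp φ) := by
  refine .taut fun v hb hi => ?_
  simp only [Form.neg, hi, hb]
  cases v φ <;> rfl

theorem to_neg_neg (φ : Form) : Hil ax (φ.imp φ.neg.neg) := by
  refine .taut fun v hb hi => ?_
  simp only [Form.neg, hi, hb]
  cases v φ <;> rfl

/-- From `χ → (ψ → ¬φ)` infer `φ → (χ → ¬ψ)`. -/
theorem rotate_neg {φ ψ χ : Form} (h : Hil ax (χ.imp (ψ.imp φ.neg))) :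
    Hil ax (φ.imp (χ.imp ψ.neg)) := by
  refine .mp (.taut fun v hb hi => ?_) h
  simp only [Form.neg, hi, hb]
  cases v φ <;> cases v ψ <;> cases v χ <;> rfl

end Hil

/-! ### Theories closed under the infinitary rule BG -/

/-- Theories of `Hil ax` closed under the infinitary version of the rule L(BG). -/
structure OmegaTheory (ax : Set Form) (T : Set Form) : Prop where
  thm : ∀ {φ : Form}, Hil ax φ → φ ∈ T
  mp : ∀ {φ ψ : Form}, φ.imp ψ ∈ T → φ ∈ T → ψ ∈ T
  omega : ∀ (L : NForm) (n : ℕ) (φ : Form),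
    (∀ m, L.fill (Form.bgPremise n m φ) ∈ T) → L.fill (Form.atf n (Form.fr φ)) ∈ T

/-- Consistent, negation-complete omega-theories. -/
structure MaxOmegaTheory (ax : Set Form) (T : Set Form) : Prop extends OmegaTheory ax T where
  bot_notMem : Form.bot ∉ T
  complete : ∀ φ : Form, φ ∈ T ∨ φ.neg ∈ T

namespace OmegaTheory
variable {ax T : Set Form}

theorem hil (ax : Set Form) : OmegaTheory ax {φ | Hil ax φ} where
  thm h := h
  mp h₁ h₂ := h₁.mp h₂
  omega L n φ h := by
    obtain ⟨m, hm⟩ := Infinite.exists_notMem_finset (L.fill (Form.atf n (Form.fr φ))).noms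
    exact Hil.lbg L n m hm (h m)

theorem adjoin (hT : OmegaTheory ax T) (ψ : Form) : OmegaTheory ax {χ | ψ.imp χ ∈ T} where
  thm h := hT.mp (hT.thm (Hil.imp_intro _ _)) (hT.thm h)
  mp h₁ h₂ := hT.mp (hT.mp (hT.thm (Hil.imp_distrib _ _ _)) h₁) h₂
  omega L n φ h := hT.omega (NForm.imp ψ L) n φ h

theorem subset_adjoin (hT : OmegaTheory ax T) (ψ : Form) : T ⊆ {χ | ψ.imp χ ∈ T} :=
  fun _ h => hT.mp (hT.thm (Hil.imp_intro _ _)) h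

theorem self_mem_adjoin (hT : OmegaTheory ax T) (ψ : Form) : ψ ∈ {χ | ψ.imp χ ∈ T} :=
  hT.thm (Hil.imp_self ψ)

theorem bot_notMem_adjoin_neg (hT : OmegaTheory ax T) {ψ : Form} (h : ψ ∉ T) :
    Form.bot ∉ {χ | ψ.neg.imp χ ∈ T} :=
  fun h' => h (hT.mp (hT.thm (Hil.of_neg_neg ψ)) h')

/-- What must be decided on the way to a maximal omega-theory: membership of a formula, or an
instance of the infinitary rule. -/
def Decides (T : Set Form) : Form ⊕ NForm × ℕ × Form → Prop
  | .inl φ => φ ∈ T ∨ φ.neg ∈ T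
  | .inr (L, n, φ) => L.fill (Form.atf n (Form.fr φ)) ∈ T ∨
      ∃ m, (L.fill (Form.bgPremise n m φ)).neg ∈ T

theorem Decides.mono {S T : Set Form} (h : S ⊆ T) :
    ∀ {r : Form ⊕ NForm × ℕ × Form}, Decides S r → Decides T r
  | .inl _ => Or.imp (@h _) (@h _)
  | .inr (_, _, _) => Or.imp (@h _) fun ⟨m, hm⟩ => ⟨m, h hm⟩

theorem exists_decides (hT : OmegaTheory ax T) (hb : Form.bot ∉ T) :
    ∀ r : Form ⊕ NForm × ℕ × Form,
      ∃ S, (OmegaTheory ax S ∧ Form.bot ∉ S) ∧ T ⊆ S ∧ Decides S r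
  | .inl φ => by
    by_cases h : φ ∈ T
    · exact ⟨T, ⟨hT, hb⟩, subset_rfl, .inl h⟩
    · exact ⟨_, ⟨hT.adjoin φ.neg, hT.bot_notMem_adjoin_neg h⟩, hT.subset_adjoin _,
        .inr (hT.self_mem_adjoin _)⟩
  | .inr (L, n, φ) => by
    by_cases h : ∀ m, L.fill (Form.bgPremise n m φ) ∈ T
    · exact ⟨T, ⟨hT, hb⟩, subset_rfl, .inl (hT.omega L n φ h)⟩
    · push Not at h
      obtain ⟨m, hm⟩ := h
      exact ⟨_, ⟨hT.adjoin _, hT.bot_notMem_adjoin_neg hm⟩, hT.subset_adjoin _,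
        .inr ⟨m, hT.self_mem_adjoin _⟩⟩

theorem exists_maxOmegaTheory (hT : OmegaTheory ax T) (hb : Form.bot ∉ T) :
    ∃ S, T ⊆ S ∧ MaxOmegaTheory ax S := by
  have : Nonempty (Form ⊕ NForm × ℕ × Form) := ⟨.inl Form.bot⟩
  obtain ⟨e, he⟩ := exists_surjective_nat (Form ⊕ NForm × ℕ × Form)
  choose next hnext hsub hdec using
    fun (r : Form ⊕ NForm × ℕ × Form) (S : {S // OmegaTheory ax S ∧ Form.bot ∉ S}) =>
      exists_decides S.2.1 S.2.2 r
  let c : ℕ → {S // OmegaTheory ax S ∧ Form.bot ∉ S} :=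
    fun k => Nat.rec ⟨T, hT, hb⟩ (fun i S => ⟨next (e i) S, hnext (e i) S⟩) k
  have hmono : Monotone fun k => (c k).1 := monotone_nat_of_le_succ fun k => hsub (e k) (c k)
  have hdecides : ∀ r, Decides (⋃ k, (c k).1) r := fun r => by
    obtain ⟨k, rfl⟩ := he r
    exact (hdec (e k) (c k)).mono (Set.subset_iUnion (fun k => (c k).1) (k + 1))
  have hbot : Form.bot ∉ ⋃ k, (c k).1 := by
    rw [Set.mem_iUnion]
    rintro ⟨k, hk⟩
    exact (c k).2.2 hk
  have hmp : ∀ {φ ψ : Form}, φ.imp ψ ∈ ⋃ k, (c k).1 → φ ∈ ⋃ k, (c k).1 →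
      ψ ∈ ⋃ k, (c k).1 := by
    intro φ ψ h₁ h₂
    obtain ⟨i, hi⟩ := Set.mem_iUnion.1 h₁
    obtain ⟨j, hj⟩ := Set.mem_iUnion.1 h₂
    exact Set.mem_iUnion.2 ⟨max i j, (c (max i j)).2.1.mp (hmono (le_max_left i j) hi)
      (hmono (le_max_right i j) hj)⟩
  refine ⟨⋃ k, (c k).1, Set.subset_iUnion (fun k => (c k).1) 0,
    { thm := fun h => Set.mem_iUnion.2 ⟨0, hT.thm h⟩, mp := hmp, omega := ?_,
      bot_notMem := hbot, complete := fun φ => hdecides (.inl φ) }⟩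
  intro L n φ h
  rcases hdecides (.inr (L, n, φ)) with h' | ⟨m, hm⟩
  · exact h'
  · exact (hbot (hmp hm (h m))).elim

end OmegaTheory

namespace MaxOmegaTheory
variable {ax Γ : Set Form} {φ ψ : Form} {n m k : ℕ}

theorem imp_mem (h : MaxOmegaTheory ax Γ) (hφ : Hil ax (φ.imp ψ)) (h' : φ ∈ Γ) : ψ ∈ Γ :=
  h.mp (h.thm hφ) h'

theorem neg_mem_iff (h : MaxOmegaTheory ax Γ) : φ.neg ∈ Γ ↔ φ ∉ Γ :=
  ⟨fun h₁ h₂ => h.bot_notMem (h.mp h₁ h₂), (h.complete φ).resolve_left⟩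

theorem atf_neg_mem_iff (h : MaxOmegaTheory ax Γ) : Form.atf n φ.neg ∈ Γ ↔ Form.atf n φ ∉ Γ := by
  rw [← h.neg_mem_iff]
  exact ⟨h.imp_mem (Hil.atf_neg n φ).iff_mpr, h.imp_mem (Hil.atf_neg n φ).iff_mp⟩

theorem atf_mp (h : MaxOmegaTheory ax Γ) (h₁ : Form.atf n (φ.imp ψ) ∈ Γ)
    (h₂ : Form.atf n φ ∈ Γ) : Form.atf n ψ ∈ Γ :=
  h.mp (h.imp_mem (Hil.atf_imp n φ ψ) h₁) h₂

theorem atf_imp_mem (h : MaxOmegaTheory ax Γ) (hφ : Hil ax (φ.imp ψ)) (h' : Form.atf n φ ∈ Γ) :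
    Form.atf n ψ ∈ Γ :=
  h.atf_mp (h.thm (hφ.necAt n)) h'

theorem atf_imp_mem_iff (h : MaxOmegaTheory ax Γ) :
    Form.atf n (φ.imp ψ) ∈ Γ ↔ (Form.atf n φ ∈ Γ → Form.atf n ψ ∈ Γ) := by
  refine ⟨h.atf_mp, fun h' => ?_⟩
  by_cases hφ : Form.atf n φ ∈ Γ
  · exact h.atf_imp_mem (Hil.imp_intro ψ φ) (h' hφ)
  · exact h.atf_imp_mem (Hil.neg_imp φ ψ) (h.atf_neg_mem_iff.2 hφ)

theorem atf_bot_notMem (h : MaxOmegaTheory ax Γ) : Form.atf n Form.bot ∉ Γ :=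
  h.atf_neg_mem_iff.1 (h.thm ((Hil.imp_self Form.bot).necAt n))

theorem atf_atf_mem_iff (h : MaxOmegaTheory ax Γ) :
    Form.atf n (Form.atf m φ) ∈ Γ ↔ Form.atf m φ ∈ Γ := by
  refine ⟨h.imp_mem (Hil.atf_agree n m φ), fun h' => ?_⟩
  by_contra hn
  exact h.atf_neg_mem_iff.1 (h.imp_mem (Hil.atf_agree n m φ.neg)
    (h.atf_imp_mem (Hil.atf_neg m φ).iff_mp (h.atf_neg_mem_iff.2 hn))) h'

theorem atf_mem_of_nom (h : MaxOmegaTheory ax Γ) (hnm : Form.atf n (Form.nom m) ∈ Γ)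
    (hφ : Form.atf m φ ∈ Γ) : Form.atf n φ ∈ Γ :=
  h.atf_mp (h.atf_imp_mem (Hil.atf_elim m φ) (h.atf_atf_mem_iff.2 hφ)) hnm

theorem atf_mem_iff_of_nom (h : MaxOmegaTheory ax Γ) (hnm : Form.atf n (Form.nom m) ∈ Γ) :
    Form.atf n φ ∈ Γ ↔ Form.atf m φ ∈ Γ := by
  refine ⟨fun hφ => ?_, h.atf_mem_of_nom hnm⟩
  by_contra hm
  exact h.atf_neg_mem_iff.1 (h.atf_mem_of_nom hnm (h.atf_neg_mem_iff.2 hm)) hφ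

theorem nom_symm (h : MaxOmegaTheory ax Γ) (hnm : Form.atf n (Form.nom m) ∈ Γ) :
    Form.atf m (Form.nom n) ∈ Γ :=
  (h.atf_mem_iff_of_nom hnm).1 (h.thm (Hil.refAx n))

/-- The equality of agents according to `Γ`. -/
def agentSetoid (h : MaxOmegaTheory ax Γ) : Setoid ℕ where
  r n m := Form.atf n (Form.nom m) ∈ Γ
  iseqv := ⟨fun n => h.thm (Hil.refAx n), h.nom_symm, h.atf_mem_of_nom⟩

theorem atf_mem_of_fr (h : MaxOmegaTheory ax Γ) (h₁ : Form.atf n φ.fr ∈ Γ)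
    (h₂ : Form.atf n (Form.nom m).diaF ∈ Γ) : Form.atf m φ ∈ Γ := by
  by_contra hm
  refine h.atf_neg_mem_iff.1 h₂ ?_
  have h₃ : Form.atf n (Form.atf m φ.neg).fr ∈ Γ :=
    h.atf_imp_mem (Hil.atf_back m φ.neg) (h.atf_atf_mem_iff.2 (h.atf_neg_mem_iff.2 hm))
  have h₄ : Hil ax (φ.fr.imp ((Form.atf m φ.neg).imp (Form.nom m).neg).fr) :=
    (Hil.fr_imp _ _).mp (Hil.atf_elim m φ.neg).rotate_neg.necF
  exact h.atf_mp (h.atf_imp_mem (Hil.fr_imp _ _) (h.atf_imp_mem h₄ h₁)) h₃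

theorem diaF_nom_congr (h : MaxOmegaTheory ax Γ) (h₁ : Form.atf n (Form.nom m).diaF ∈ Γ)
    (h₂ : Form.atf m (Form.nom k) ∈ Γ) : Form.atf n (Form.nom k).diaF ∈ Γ := by
  refine h.atf_neg_mem_iff.2 fun h₃ => ?_
  exact h.atf_neg_mem_iff.1 (h.atf_mem_of_fr h₃ h₁) h₂

theorem atf_fr_mem (h : MaxOmegaTheory ax Γ)
    (h' : ∀ m, Form.atf n (Form.nom m).diaF ∈ Γ → Form.atf m φ ∈ Γ) : Form.atf n φ.fr ∈ Γ := by
  refine h.omega .hole n φ fun m => ?_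
  by_cases hm : Form.atf n (Form.nom m).diaF ∈ Γ
  · exact h.imp_mem (Hil.imp_intro _ _) (h' m hm)
  · exact h.imp_mem (Hil.neg_imp _ _) (h.neg_mem_iff.2 hm)

theorem atf_box_mp (h : MaxOmegaTheory ax Γ) (h₁ : Form.atf n (φ.imp ψ).box ∈ Γ)
    (h₂ : Form.atf n φ.box ∈ Γ) : Form.atf n ψ.box ∈ Γ :=
  h.atf_mp (h.atf_imp_mem (Hil.box_imp φ ψ) h₁) h₂

theorem omegaTheory_box (h : MaxOmegaTheory ax Γ) (n : ℕ) :
    OmegaTheory ax {ψ | Form.atf n ψ.box ∈ Γ} where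
  thm hφ := h.thm (hφ.necBox.necAt n)
  mp := h.atf_box_mp
  omega L := h.omega (NForm.atBox n L)

theorem exists_of_atf_box_notMem (h : MaxOmegaTheory ax Γ) (hφ : Form.atf n φ.box ∉ Γ) :
    ∃ Δ, MaxOmegaTheory ax Δ ∧ (∀ ψ : Form, Form.atf n ψ.box ∈ Γ → Form.atf n ψ ∈ Δ) ∧
      Form.atf n φ ∉ Δ := by
  have hu := h.omegaTheory_box n
  have hn : Form.atf n φ ∉ {ψ | Form.atf n ψ.box ∈ Γ} :=
    fun h' => hφ (h.imp_mem (Hil.atf_dcom n φ).iff_mp h')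
  obtain ⟨Δ, hsub, hΔ⟩ :=
    (hu.adjoin (Form.atf n φ).neg).exists_maxOmegaTheory (hu.bot_notMem_adjoin_neg hn)
  exact ⟨Δ, hΔ, fun ψ hψ => hsub (hu.subset_adjoin _ (h.imp_mem (Hil.atf_dcom n ψ).iff_mpr hψ)),
    hΔ.neg_mem_iff.1 (hsub (hu.self_mem_adjoin _))⟩

theorem nom_mem_iff_of_box {Δ : Set Form} (h : MaxOmegaTheory ax Γ) (hΔ : MaxOmegaTheory ax Δ)
    (hR : ∀ ψ : Form, Form.atf n ψ.box ∈ Γ → Form.atf n ψ ∈ Δ) :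
    Form.atf m (Form.nom k) ∈ Δ ↔ Form.atf m (Form.nom k) ∈ Γ := by
  constructor
  · intro h'
    by_contra hn
    have hb : Form.atf n (Form.atf m (Form.nom k)).neg ∈ Γ :=
      h.atf_neg_mem_iff.2 fun hc => hn (h.atf_atf_mem_iff.1 hc)
    exact hΔ.atf_neg_mem_iff.1 (hR _ (h.atf_imp_mem (Hil.rigidNeq m k) hb))
      (hΔ.atf_atf_mem_iff.2 h')
  · intro h'
    exact hΔ.atf_atf_mem_iff.1
      (hR _ (h.atf_imp_mem (Hil.rigidEq m k) (h.atf_atf_mem_iff.2 h')))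

/-! ### The canonical model -/

/-- Maximal omega-theories with the same equality of agents as `Γ`. -/
abbrev State (ax Γ : Set Form) : Type :=
  {Δ : Set Form // MaxOmegaTheory ax Δ ∧
    ∀ n m, Form.atf n (Form.nom m) ∈ Δ ↔ Form.atf n (Form.nom m) ∈ Γ}

/-- The agents according to `Γ`: nominals up to provable equality. -/
abbrev Agent (h : MaxOmegaTheory ax Γ) : Type := Quotient h.agentSetoid

/-- The canonical frame of states sharing the agents of `Γ`. -/
noncomputable def canonicalFrame (h : MaxOmegaTheory ax Γ) : Frame (State ax Γ) h.Agent where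
  wne := ⟨⟨Γ, h, fun _ _ => Iff.rfl⟩⟩
  ane := ⟨Quotient.mk _ 0⟩
  R a w v := ∀ ψ : Form, Form.atf a.out ψ.box ∈ w.1 → Form.atf a.out ψ ∈ v.1
  friend w a b := Form.atf a.out (Form.nom b.out).diaF ∈ w.1

/-- The canonical model of states sharing the agents of `Γ`. -/
noncomputable def canonicalModel (h : MaxOmegaTheory ax Γ) : Model (State ax Γ) h.Agent where
  toFrame := h.canonicalFrame
  Vp p w a := Form.atf a.out (Form.pv p) ∈ w.1
  Vn n := Quotient.mk _ n

theorem atf_out_nom_mem (h : MaxOmegaTheory ax Γ) (w : State ax Γ) (n : ℕ) :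
    Form.atf (Quotient.mk h.agentSetoid n).out (Form.nom n) ∈ w.1 :=
  (w.2.2 _ _).2 (Quotient.mk_out (s := h.agentSetoid) n)

theorem sat_canonicalModel (h : MaxOmegaTheory ax Γ) (φ : Form) :
    ∀ (w : State ax Γ) (a : h.Agent), Sat h.canonicalModel w a φ ↔ Form.atf a.out φ ∈ w.1 := by
  induction φ with
  | nom n =>
    intro w a
    rw [w.2.2]
    change Quotient.mk h.agentSetoid n = a ↔ _
    rw [Quotient.mk_eq_iff_out]
    exact ⟨h.nom_symm, h.nom_symm⟩
  | pv p => intro w a; rfl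
  | bot => intro w a; exact iff_of_false id w.2.1.atf_bot_notMem
  | imp φ ψ ih₁ ih₂ =>
    intro w a
    rw [w.2.1.atf_imp_mem_iff, ← ih₁, ← ih₂]
    rfl
  | atf n φ ih =>
    intro w a
    rw [w.2.1.atf_atf_mem_iff, ← w.2.1.atf_mem_iff_of_nom (h.atf_out_nom_mem w n)]
    exact ih w _
  | fr φ ih =>
    intro w a
    refine ⟨fun hs => w.2.1.atf_fr_mem fun m hm => ?_,
      fun hs b hb => (ih w b).2 (w.2.1.atf_mem_of_fr hs hb)⟩
    have hout := h.atf_out_nom_mem w m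
    rw [← w.2.1.atf_mem_iff_of_nom hout]
    exact (ih w _).1 (hs _ (w.2.1.diaF_nom_congr hm (w.2.1.nom_symm hout)))
  | box φ ih =>
    intro w a
    refine ⟨fun hs => ?_, fun hs v hv => (ih v a).2 (hv φ hs)⟩
    by_contra hn
    obtain ⟨Δ, hΔ, hR, hφ⟩ := w.2.1.exists_of_atf_box_notMem hn
    let v : State ax Γ :=
      ⟨Δ, hΔ, fun n m => (w.2.1.nom_mem_iff_of_box hΔ hR).trans (w.2.2 n m)⟩
    exact hφ ((ih v a).1 (hs v hR))

/-- Regular implications among the axioms are valid in the canonical frame, because all agents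
are named by nominals. -/
theorem canonicalFrame_valid_of_isRegImp (h : MaxOmegaTheory ax Γ) (hφ : φ ∈ ax)
    (hr : IsRegImp φ) : FrameValid h.canonicalFrame φ := by
  intro Vp Vn w a
  have hsub : Sat h.canonicalModel w a (ApplySub Form.pv (fun n => (Vn n).out) φ) :=
    (h.sat_canonicalModel _ w a).2 (w.2.1.thm (((Hil.extra hφ).us _ _).necAt _))
  rw [sat_applySub] at hsub
  have hVn : h.canonicalModel.Vn ∘ (fun n => (Vn n).out) = Vn :=
    funext fun n => Quotient.out_eq (Vn n)
  rw [hVn] at hsub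
  have hρ : ∀ (Vp' : ℕ → State ax Γ → h.Agent → Prop) (ρ : Form), IsRho ρ →
      (Sat { toFrame := h.canonicalFrame, Vp := Vp', Vn := Vn } w a ρ ↔
        Sat { toFrame := h.canonicalFrame, Vp := Vp, Vn := Vn } w a ρ) := by
    rintro Vp' ρ (⟨n, m, rfl⟩ | ⟨n, m, rfl⟩) <;> rfl
  obtain ⟨l₁, l₂, h₁, h₂, rfl⟩ := hr
  intro hc
  rw [sat_conjList] at hc
  rw [sat_disjList]
  obtain ⟨ρ, hm, hs⟩ := (sat_disjList _ w a l₂).1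
    (hsub ((sat_conjList _ w a l₁).2 fun ρ hm => (hρ _ ρ (h₁ ρ hm)).2 (hc ρ hm)))
  exact ⟨ρ, hm, (hρ _ ρ (h₂ ρ hm)).1 hs⟩

theorem canonicalFrame_valid_S4 (h : MaxOmegaTheory ax Γ) (hax : S4Ax ⊆ ax) :
    ∀ ψ ∈ S4Ax, FrameValid h.canonicalFrame ψ := by
  have hT (φ : Form) : Hil ax (φ.box.imp φ) :=
    (Hil.extra (hax (Or.inl rfl))).us (Hil.pairSub φ φ) id
  have h4 (φ : Form) : Hil ax (φ.box.imp φ.box.box) :=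
    (Hil.extra (hax (Or.inr rfl))).us (Hil.pairSub φ φ) id
  rintro ψ (rfl | rfl) Vp Vn w a hs
  · exact hs w fun ψ hψ => w.2.1.atf_imp_mem (hT ψ) hψ
  · exact fun v hv u hu => hs u fun ψ hψ => hu ψ (hv _ (w.2.1.atf_imp_mem (h4 ψ) hψ))

theorem canonicalFrame_valid_S5 (h : MaxOmegaTheory ax Γ) (hax : S5Ax ⊆ ax) :
    ∀ ψ ∈ S5Ax, FrameValid h.canonicalFrame ψ := by
  rintro ψ (hψ | rfl)
  · exact h.canonicalFrame_valid_S4 (Set.subset_union_left.trans hax) ψ hψ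
  have hB (φ : Form) : Hil ax (φ.imp φ.neg.box.neg.box) :=
    (Hil.extra (hax (Or.inr rfl))).us (Hil.pairSub φ φ) id
  intro Vp Vn w a hs v hv hv'
  refine hv' w (fun ψ hψ => ?_) hs
  by_contra hn
  have h₁ := hv _ (w.2.1.atf_imp_mem (hB ψ.neg) (w.2.1.atf_neg_mem_iff.2 hn))
  exact v.2.1.atf_neg_mem_iff.1 h₁
    (v.2.1.atf_imp_mem ((Hil.box_imp _ _).mp (Hil.to_neg_neg ψ).necBox) hψ)

end MaxOmegaTheory

/-- An unprovable formula is refuted at a nominal by some maximal omega-theory. -/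
theorem exists_maxOmegaTheory_of_not_hil {ax : Set Form} {φ : Form} (hφ : ¬ Hil ax φ) :
    ∃ (n : ℕ) (Γ : Set Form), MaxOmegaTheory ax Γ ∧ Form.atf n φ ∉ Γ := by
  obtain ⟨n, hn⟩ := Infinite.exists_notMem_finset φ.noms
  have hu := OmegaTheory.hil ax
  have hat : Form.atf n φ ∉ {φ | Hil ax φ} :=
    fun h => hφ (Hil.name n hn ((Hil.atf_elim n φ).mp h))
  obtain ⟨Γ, hsub, hΓ⟩ :=
    (hu.adjoin (Form.atf n φ).neg).exists_maxOmegaTheory (hu.bot_notMem_adjoin_neg hat)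
  exact ⟨n, Γ, hΓ, hΓ.neg_mem_iff.1 (hsub (hu.self_mem_adjoin _))⟩

/-- soundness and completeness of the extensions HEFL(Λ∪Θ),
    Λ ∈ {S4, S5}, Θ a finite set of regular implications, with respect to the
    class of models whose frame validates Λ∪Θ. -/
theorem HEFL_ext_sound_complete (Λ : Set Form) (hΛ : Λ = S4Ax ∨ Λ = S5Ax)
    (Θ : Finset Form) (hΘ : ∀ ψ ∈ Θ, IsRegImp ψ) (φ : Form) :
    (∀ (W A : Type) (M : Model W A),
        (∀ ψ ∈ Λ ∪ ↑Θ, FrameValid M.toFrame ψ) →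
        ∀ (w : W) (a : A), Sat M w a φ)
    ↔ Hil (Λ ∪ ↑Θ) φ := by
  refine ⟨fun hvalid => ?_, fun hh W A M hM w a => hh.frameValid hM M.Vp M.Vn w a⟩
  by_contra hφ
  obtain ⟨n, Γ, h, hn⟩ := exists_maxOmegaTheory_of_not_hil hφ
  have hframe : ∀ ψ ∈ Λ ∪ ↑Θ, FrameValid h.canonicalFrame ψ := by
    rintro ψ (hψ | hψ)
    · rcases hΛ with rfl | rfl
      · exact h.canonicalFrame_valid_S4 Set.subset_union_left ψ hψ
      · exact h.canonicalFrame_valid_S5 Set.subset_union_left ψ hψ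
    · exact h.canonicalFrame_valid_of_isRegImp (Or.inr hψ) (hΘ ψ hψ)
  let w : MaxOmegaTheory.State (Λ ∪ ↑Θ) Γ := ⟨Γ, h, fun _ _ => Iff.rfl⟩
  have hs := (h.sat_canonicalModel φ w (Quotient.mk _ n)).1
    (hvalid _ _ h.canonicalModel hframe w _)
  exact hn ((h.atf_mem_iff_of_nom (h.atf_out_nom_mem w n)).1 hs)
end
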